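/- Let α ∈ (0,1) be a Liouville number. For every r ∈ ℕ there exists a lift f of an orientation-preserving C^∞ circle diffeomorphism with rotation number ρ(f) = α such that d_r(f, R_α) < 2^{−r} and the circle diffeomorphism induced by f has ratio set r(f) = {0, 1} (i.e. it is of type III₀). -/

import Mathlib

noncomputable section
open MeasureTheory Filter Topology

/-- A lift of an orientation-preserving `C^∞` circle diffeomorphism: a `C^∞` map
`f : ℝ → ℝ` with `f (x+1) = f x + 1` and everywhere positive derivative. -/
def IsCircleDiffeoLift (f : ℝ → ℝ) : Prop :=
  ContDiff ℝ (⊤ : ℕ∞) f ∧ (∀ x : ℝ, f (x + 1) = f x + 1) ∧ ∀ x : ℝ, 0 < deriv f x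

/-- The `C^r` norm `‖φ‖_r = max_{0 ≤ i ≤ r} sup_x |φ^{(i)}(x)|`. -/
def CrNorm (r : ℕ) (φ : ℝ → ℝ) : ℝ :=
  (Finset.range (r + 1)).sup' (Finset.nonempty_range_iff.mpr r.succ_ne_zero)
    fun i => ⨆ x : ℝ, |iteratedDeriv i φ x|

/-- `d_r(f, g) = max {‖f - g‖_r, ‖f⁻¹ - g⁻¹‖_r}`. -/
def liftDist (r : ℕ) (f g : ℝ → ℝ) : ℝ :=
  max (CrNorm r (fun x => f x - g x))
    (CrNorm r (fun x => Function.invFun f x - Function.invFun g x))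

/-- `|f|_r = max {‖f - id‖_r, ‖f⁻¹ - id‖_r, 1}`. -/
def liftNorm (r : ℕ) (f : ℝ → ℝ) : ℝ :=
  max (max (CrNorm r (fun x => f x - x)) (CrNorm r (fun x => Function.invFun f x - x))) 1

/-- The lift `x ↦ x + a` of the rotation by `a`. -/
def RotLift (a : ℝ) : ℝ → ℝ := fun x => x + a

/-- The rotation number of the circle diffeomorphism induced by the lift `f` equals `a`
(mod 1): the translation number `lim (fⁿ(0) - 0)/n` equals `a + k` for some integer `k`. -/
def HasRotationNumber (f : ℝ → ℝ) (a : ℝ) : Prop :=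
  ∃ k : ℤ, Tendsto (fun n : ℕ => f^[n] 0 / (n : ℝ)) atTop (nhds (a + k))

/-- The lift of the `i`-th iterate (`i ∈ ℤ`) of the circle diffeomorphism induced by `f`. -/
def zpowLift (f : ℝ → ℝ) : ℤ → ℝ → ℝ := fun i =>
  if 0 ≤ i then f^[i.toNat] else (Function.invFun f)^[(-i).toNat]

/-- The ratio set of a circle diffeomorphism, described through the family `Fz i` of its
iterates (`i ∈ ℤ`) and the family `D i` of the derivatives of its iterates: `t ≥ 0` lies in
the ratio set iff for every Borel `A` of positive Haar measure and every `ε > 0` there are a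
Borel `B ⊆ A` of positive measure and `i ∈ ℤ` with `Fz i '' B ⊆ A` and `|D i x - t| < ε`
on `B`. -/
def ratioSet (Fz : ℤ → UnitAddCircle → UnitAddCircle) (D : ℤ → UnitAddCircle → ℝ) : Set ℝ :=
  {t : ℝ | 0 ≤ t ∧ ∀ A : Set UnitAddCircle, MeasurableSet A → 0 < volume A →
    ∀ ε : ℝ, 0 < ε → ∃ B : Set UnitAddCircle, MeasurableSet B ∧ B ⊆ A ∧ 0 < volume B ∧
      ∃ i : ℤ, Fz i '' B ⊆ A ∧ ∀ x ∈ B, |D i x - t| < ε}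

/-- A lift of an orientation-preserving `C¹` circle diffeomorphism. -/
def IsC1CircleLift (f : ℝ → ℝ) : Prop :=
  ContDiff ℝ 1 f ∧ (∀ x : ℝ, f (x + 1) = f x + 1) ∧ ∀ x : ℝ, 0 < deriv f x

/-! ### Periodic functions on the line -/

theorem abs_le_of_continuous_of_periodic {φ : ℝ → ℝ} (hc : Continuous φ)
    (hp : Function.Periodic φ 1) : ∃ C : ℝ, 0 < C ∧ ∀ x, |φ x| ≤ C := by
  obtain ⟨C, hC, h⟩ := (hp.isBounded_of_continuous one_ne_zero hc).exists_pos_norm_le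
  exact ⟨C, hC, fun x => h _ ⟨x, rfl⟩⟩

theorem exists_pos_le_of_continuous_of_periodic {φ : ℝ → ℝ} (hc : Continuous φ)
    (hp : Function.Periodic φ 1) (hpos : ∀ x, 0 < φ x) : ∃ c : ℝ, 0 < c ∧ ∀ x, c ≤ φ x := by
  obtain ⟨C, hC, h⟩ := abs_le_of_continuous_of_periodic
    (hc.inv₀ fun x => (hpos x).ne') (fun x => by simp [hp x])
  refine ⟨C⁻¹, inv_pos.2 hC, fun x => ?_⟩
  have := h x
  rw [Pi.inv_apply, abs_of_pos (inv_pos.2 (hpos x))] at this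
  exact inv_le_of_inv_le₀ (hpos x) this

theorem uniformContinuous_of_periodic {φ : ℝ → ℝ} (hc : Continuous φ)
    (hp : Function.Periodic φ 1) : UniformContinuous φ := by
  have hu := (isCompact_Icc (a := (-1 : ℝ)) (b := 2)).uniformContinuousOn_of_continuous
    hc.continuousOn
  rw [Metric.uniformContinuousOn_iff] at hu
  rw [Metric.uniformContinuous_iff]
  intro ε hε
  obtain ⟨δ, hδ, h⟩ := hu ε hε
  refine ⟨min δ 1, lt_min hδ one_pos, fun {x y} hxy => ?_⟩
  have h1 := Int.floor_le x
  have h2 := Int.lt_floor_add_one x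
  have h3 : |x - y| < 1 := lt_of_lt_of_le hxy (min_le_right _ _)
  rw [abs_lt] at h3
  have h4 := h (x - ⌊x⌋) ⟨by linarith, by linarith⟩ (y - ⌊x⌋) ⟨by linarith, by linarith⟩
    (by
      rw [Real.dist_eq] at hxy ⊢
      rw [sub_sub_sub_cancel_right]
      exact lt_of_lt_of_le hxy (min_le_left _ _))
  have hx := hp.sub_zsmul_eq (x := x) ⌊x⌋
  have hy := hp.sub_zsmul_eq (x := y) ⌊x⌋
  simp only [zsmul_eq_mul, mul_one] at hx hy
  rwa [hx, hy] at h4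

theorem exists_abs_div_sub_one_le {φ : ℝ → ℝ} (hc : Continuous φ) (hp : Function.Periodic φ 1)
    (hpos : ∀ x, 0 < φ x) {θ : ℝ} (hθ : 0 < θ) :
    ∃ δ : ℝ, 0 < δ ∧ ∀ a b, |a - b| ≤ δ → |φ a / φ b - 1| ≤ θ := by
  obtain ⟨c, hc0, hcle⟩ := exists_pos_le_of_continuous_of_periodic hc hp hpos
  obtain ⟨δ, hδ, h⟩ := Metric.uniformContinuous_iff.1 (uniformContinuous_of_periodic hc hp)
    (θ * c) (mul_pos hθ hc0)
  refine ⟨δ / 2, half_pos hδ, fun a b hab => ?_⟩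
  have h1 := h (a := a) (b := b) (by rw [Real.dist_eq]; linarith)
  rw [Real.dist_eq] at h1
  have hb := hpos b
  rw [div_sub_one hb.ne', abs_div, abs_of_pos hb, div_le_iff₀ hb]
  nlinarith [hcle b]

/-! ### Pairs of mutually inverse smooth lifts -/

/-- `h` and `k` are mutually inverse lifts of orientation-preserving smooth circle
diffeomorphisms. -/
structure LiftPair (h k : ℝ → ℝ) : Prop where
  smooth : ContDiff ℝ (⊤ : ℕ∞) h
  smooth_inv : ContDiff ℝ (⊤ : ℕ∞) k
  add_one : ∀ x, h (x + 1) = h x + 1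
  add_one_inv : ∀ x, k (x + 1) = k x + 1
  apply_inv : ∀ x, h (k x) = x
  inv_apply : ∀ x, k (h x) = x
  deriv_pos : ∀ x, 0 < deriv h x

theorem add_intCast_of_add_one {h : ℝ → ℝ} (hh : ∀ x, h (x + 1) = h x + 1) (x : ℝ) (m : ℤ) :
    h (x + m) = h x + m := by
  have hp : Function.Periodic (fun x => h x - x) 1 := fun x => by simp only [hh]; ring
  have := hp.int_mul m x
  simp only [mul_one] at this
  linarith

theorem periodic_deriv_of_add_one {h : ℝ → ℝ} (hh : ∀ x, h (x + 1) = h x + 1) :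
    Function.Periodic (deriv h) 1 := fun x => by
  rw [← deriv_comp_add_const, funext hh]
  simp

namespace LiftPair

variable {h k g l : ℝ → ℝ}

theorem differentiable (p : LiftPair h k) : Differentiable ℝ h :=
  p.smooth.differentiable (by simp)

theorem differentiable_inv (p : LiftPair h k) : Differentiable ℝ k :=
  p.smooth_inv.differentiable (by simp)

theorem contDiff_deriv (p : LiftPair h k) : ContDiff ℝ (⊤ : ℕ∞) (deriv h) :=
  (contDiff_infty_iff_deriv.1 p.smooth).2

theorem deriv_mul_deriv_inv (p : LiftPair h k) (x : ℝ) : deriv h (k x) * deriv k x = 1 := by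
  have h1 := ((p.differentiable (k x)).hasDerivAt.comp x (p.differentiable_inv x).hasDerivAt)
  rw [show h ∘ k = id from funext p.apply_inv] at h1
  exact h1.unique (hasDerivAt_id x)

theorem symm (p : LiftPair h k) : LiftPair k h where
  smooth := p.smooth_inv
  smooth_inv := p.smooth
  add_one := p.add_one_inv
  add_one_inv := p.add_one
  apply_inv := p.inv_apply
  inv_apply := p.apply_inv
  deriv_pos x := pos_of_mul_pos_right (by rw [p.deriv_mul_deriv_inv x]; exact one_pos)
    (p.deriv_pos _).le

theorem comp (p : LiftPair h k) (p' : LiftPair g l) :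
    LiftPair (fun x => h (g x)) (fun x => l (k x)) where
  smooth := p.smooth.comp p'.smooth
  smooth_inv := p'.smooth_inv.comp p.smooth_inv
  add_one x := by rw [p'.add_one, p.add_one]
  add_one_inv x := by rw [p.add_one_inv, p'.add_one_inv]
  apply_inv x := by rw [p'.apply_inv, p.apply_inv]
  inv_apply x := by rw [p.inv_apply, p'.inv_apply]
  deriv_pos x := by
    have := ((p.differentiable (g x)).hasDerivAt.comp x (p'.differentiable x).hasDerivAt).deriv
    simp only [Function.comp_def] at this
    rw [this]
    exact mul_pos (p.deriv_pos _) (p'.deriv_pos _)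

theorem add_const (a : ℝ) : LiftPair (fun x => x + a) (fun x => x - a) where
  smooth := contDiff_id.add contDiff_const
  smooth_inv := contDiff_id.sub contDiff_const
  add_one x := by ring
  add_one_inv x := by ring
  apply_inv x := by ring
  inv_apply x := by ring
  deriv_pos x := by simp

protected theorem refl : LiftPair (fun x => x) (fun x => x) := by
  simpa using add_const 0

theorem conj_add_const (p : LiftPair h k) (a : ℝ) :
    LiftPair (fun x => h (k x + a)) (fun x => h (k x - a)) :=
  p.comp ((add_const a).comp p.symm)

/-- Conjugating by multiplication by `q` lifts a pair to the `q`-fold cover. -/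
theorem cover (p : LiftPair h k) {q : ℕ} (hq : 0 < q) :
    LiftPair (fun x => h (q * x) / q) (fun x => k (q * x) / q) := by
  have hq' : (q : ℝ) ≠ 0 := by positivity
  have key : ∀ {u : ℝ → ℝ}, (∀ x, u (x + 1) = u x + 1) → ∀ x : ℝ,
      u (q * (x + 1)) / q = u (q * x) / q + 1 := fun {u} hu x => by
    have := add_intCast_of_add_one hu (q * x) q
    rw [mul_add, mul_one]
    push_cast at this
    rw [this]
    field_simp
  refine ⟨?_, ?_, key p.add_one, key p.add_one_inv, fun x => ?_, fun x => ?_, fun x => ?_⟩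
  · exact (p.smooth.comp (contDiff_const.mul contDiff_id)).div_const _
  · exact (p.smooth_inv.comp (contDiff_const.mul contDiff_id)).div_const _
  · rw [mul_div_cancel₀ _ hq', p.apply_inv, mul_div_cancel_left₀ _ hq']
  · rw [mul_div_cancel₀ _ hq', p.inv_apply, mul_div_cancel_left₀ _ hq']
  · have h1 : HasDerivAt (fun x : ℝ => (q : ℝ) * x) q x := by
      simpa using (hasDerivAt_id x).const_mul (q : ℝ)
    have h2 := (((p.differentiable (q * x)).hasDerivAt.comp x h1).div_const (q : ℝ)).deriv
    simp only [Function.comp_def] at h2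
    rw [h2, mul_div_cancel_right₀ _ hq']
    exact p.deriv_pos _

theorem strictMono (p : LiftPair h k) : StrictMono h :=
  strictMono_of_deriv_pos p.deriv_pos

theorem deriv_periodic (p : LiftPair h k) : Function.Periodic (deriv h) 1 :=
  periodic_deriv_of_add_one p.add_one

theorem continuous_deriv (p : LiftPair h k) : Continuous (deriv h) :=
  p.contDiff_deriv.continuous

theorem exists_abs_sub_le (p : LiftPair h k) : ∃ C : ℝ, 0 < C ∧ ∀ x, |h x - x| ≤ C :=
  abs_le_of_continuous_of_periodic (p.smooth.continuous.sub continuous_id)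
    fun x => by simp only [p.add_one]; ring

theorem isCircleDiffeoLift (p : LiftPair h k) : IsCircleDiffeoLift h :=
  ⟨p.smooth, p.add_one, p.deriv_pos⟩

theorem invFun_eq (p : LiftPair h k) : Function.invFun h = k := by
  have hi : Function.Injective h := p.strictMono.injective
  funext x
  exact hi (by rw [Function.invFun_eq ⟨k x, p.apply_inv x⟩, p.apply_inv])

end LiftPair

theorem exists_liftPair {k : ℝ → ℝ} (hs : ContDiff ℝ (⊤ : ℕ∞) k)
    (h1 : ∀ x, k (x + 1) = k x + 1) (hpos : ∀ x, 0 < deriv k x) : ∃ h, LiftPair k h := by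
  have hmono : StrictMono k := strictMono_of_deriv_pos hpos
  have hk : ∀ m : ℤ, k m = k 0 + m := fun m => by
    simpa using add_intCast_of_add_one h1 0 m
  have htop : Tendsto k atTop atTop := by
    refine tendsto_atTop.2 fun b => ?_
    filter_upwards [eventually_ge_atTop ((⌈b - k 0⌉ : ℤ) : ℝ)] with x hx
    have := hmono.monotone hx
    rw [hk] at this
    linarith [Int.le_ceil (b - k 0)]
  have hbot : Tendsto k atBot atBot := by
    refine tendsto_atBot.2 fun b => ?_
    filter_upwards [eventually_le_atBot ((⌊b - k 0⌋ : ℤ) : ℝ)] with x hx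
    have := hmono.monotone hx
    rw [hk] at this
    linarith [Int.floor_le (b - k 0)]
  have hsurj : Function.Surjective k := hs.continuous.surjective htop hbot
  let e : ℝ ≃ₜ ℝ := (hmono.orderIsoOfSurjective k hsurj).toHomeomorph
  have he : ∀ x, e x = k x := fun _ => rfl
  refine ⟨e.symm, hs, ?_, h1, fun x => ?_, fun x => ?_, fun x => ?_, hpos⟩
  · refine e.contDiff_symm_deriv (fun x => (hpos x).ne')
      (fun x => ((hs.differentiable (by simp)) x).hasDerivAt) hs
  · apply e.injective
    rw [e.apply_symm_apply, he, h1, ← he, e.apply_symm_apply]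
  · exact e.apply_symm_apply x
  · exact e.symm_apply_apply x

/-! ### Rapidly decreasing families of functions -/

/-- The derivatives of order at most `m` of the family `φ` decrease faster than any power of the
weights `q`, uniformly on the line. -/
def RapidDecay (q : ℕ → ℝ) (m : ℕ) (φ : ℕ → ℝ → ℝ) : Prop :=
  ∀ i ≤ m, ∀ P : ℕ, ∀ᶠ j in atTop, ∀ x, |iteratedDeriv i (φ j) x| * q j ^ P ≤ 1

/-- The derivatives of order at most `m` of the family `φ` grow at most like a power of the
weights `q`, uniformly on the line. -/
def PolyGrowth (q : ℕ → ℝ) (m : ℕ) (φ : ℕ → ℝ → ℝ) : Prop :=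
  ∀ i ≤ m, ∃ P : ℕ, ∀ᶠ j in atTop, ∀ x, |iteratedDeriv i (φ j) x| ≤ q j ^ P

section Families

variable {q : ℕ → ℝ} {m : ℕ} {φ ψ : ℕ → ℝ → ℝ}

theorem rapidDecay_zero : RapidDecay q 0 φ ↔
    ∀ P : ℕ, ∀ᶠ j in atTop, ∀ x, |φ j x| * q j ^ P ≤ 1 := by
  simp [RapidDecay]

theorem rapidDecay_succ : RapidDecay q (m + 1) φ ↔
    RapidDecay q 0 φ ∧ RapidDecay q m (fun j => deriv (φ j)) := by
  constructor
  · intro h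
    refine ⟨fun i hi => h i (by omega), fun i hi P => ?_⟩
    have := h (i + 1) (by omega) P
    simpa only [iteratedDeriv_succ'] using this
  · rintro ⟨h0, h1⟩ i hi P
    cases i with
    | zero => exact h0 0 le_rfl P
    | succ i => simpa only [iteratedDeriv_succ'] using h1 i (by omega) P

theorem polyGrowth_zero : PolyGrowth q 0 φ ↔
    ∃ P : ℕ, ∀ᶠ j in atTop, ∀ x, |φ j x| ≤ q j ^ P := by
  simp [PolyGrowth]

theorem polyGrowth_succ : PolyGrowth q (m + 1) φ ↔
    PolyGrowth q 0 φ ∧ PolyGrowth q m (fun j => deriv (φ j)) := by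
  constructor
  · intro h
    refine ⟨fun i hi => h i (by omega), fun i hi => ?_⟩
    have := h (i + 1) (by omega)
    simpa only [iteratedDeriv_succ'] using this
  · rintro ⟨h0, h1⟩ i hi
    cases i with
    | zero => exact h0 0 le_rfl
    | succ i => simpa only [iteratedDeriv_succ'] using h1 i (by omega)

theorem RapidDecay.mono {n : ℕ} (h : RapidDecay q n φ) (hm : m ≤ n) : RapidDecay q m φ :=
  fun i hi => h i (hi.trans hm)

theorem PolyGrowth.mono {n : ℕ} (h : PolyGrowth q n φ) (hm : m ≤ n) : PolyGrowth q m φ :=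
  fun i hi => h i (hi.trans hm)

theorem RapidDecay.add (hq : Tendsto q atTop atTop) (hφ : ∀ j, ContDiff ℝ (⊤ : ℕ∞) (φ j))
    (hψ : ∀ j, ContDiff ℝ (⊤ : ℕ∞) (ψ j)) (h : RapidDecay q m φ) (h' : RapidDecay q m ψ) :
    RapidDecay q m (fun j x => φ j x + ψ j x) := by
  intro i hi P
  filter_upwards [h i hi (P + 1), h' i hi (P + 1), hq.eventually_ge_atTop 2] with j h1 h2 h3 x
  have hi' : (i : WithTop ℕ∞) ≤ ((⊤ : ℕ∞) : WithTop ℕ∞) := mod_cast le_top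
  have : iteratedDeriv i (fun x => φ j x + ψ j x) x
      = iteratedDeriv i (φ j) x + iteratedDeriv i (ψ j) x :=
    iteratedDeriv_fun_add ((hφ j).of_le hi').contDiffAt ((hψ j).of_le hi').contDiffAt
  rw [this]
  have hP : (0 : ℝ) ≤ q j ^ P := by positivity
  have e1 := h1 x
  have e2 := h2 x
  rw [pow_succ] at e1 e2
  have := mul_le_mul_of_nonneg_right
    (abs_add_le (iteratedDeriv i (φ j) x) (iteratedDeriv i (ψ j) x)) hP
  have a1 : 0 ≤ |iteratedDeriv i (φ j) x| * q j ^ P := by positivity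
  have a2 : 0 ≤ |iteratedDeriv i (ψ j) x| * q j ^ P := by positivity
  nlinarith

theorem PolyGrowth.add (hq : Tendsto q atTop atTop) (hφ : ∀ j, ContDiff ℝ (⊤ : ℕ∞) (φ j))
    (hψ : ∀ j, ContDiff ℝ (⊤ : ℕ∞) (ψ j)) (h : PolyGrowth q m φ) (h' : PolyGrowth q m ψ) :
    PolyGrowth q m (fun j x => φ j x + ψ j x) := by
  intro i hi
  obtain ⟨P, hP⟩ := h i hi
  obtain ⟨P', hP'⟩ := h' i hi
  refine ⟨P + P' + 1, ?_⟩
  filter_upwards [hP, hP', hq.eventually_ge_atTop 2] with j h1 h2 h3 x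
  have hi' : (i : WithTop ℕ∞) ≤ ((⊤ : ℕ∞) : WithTop ℕ∞) := mod_cast le_top
  have : iteratedDeriv i (fun x => φ j x + ψ j x) x
      = iteratedDeriv i (φ j) x + iteratedDeriv i (ψ j) x :=
    iteratedDeriv_fun_add ((hφ j).of_le hi').contDiffAt ((hψ j).of_le hi').contDiffAt
  rw [this]
  have h1q : (1 : ℝ) ≤ q j := by linarith
  have e1 : q j ^ P ≤ q j ^ (P + P') := pow_le_pow_right₀ h1q (by omega)
  have e2 : q j ^ P' ≤ q j ^ (P + P') := pow_le_pow_right₀ h1q (by omega)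
  have e3 : (0 : ℝ) ≤ q j ^ (P + P') := by positivity
  have := abs_add_le (iteratedDeriv i (φ j) x) (iteratedDeriv i (ψ j) x)
  have := h1 x
  have := h2 x
  rw [pow_succ]
  nlinarith

theorem contDiff_deriv_of_contDiff {f : ℝ → ℝ} (hf : ContDiff ℝ (⊤ : ℕ∞) f) :
    ContDiff ℝ (⊤ : ℕ∞) (deriv f) :=
  (contDiff_infty_iff_deriv.1 hf).2

theorem deriv_mul_of_contDiff {f g : ℝ → ℝ} (hf : ContDiff ℝ (⊤ : ℕ∞) f)
    (hg : ContDiff ℝ (⊤ : ℕ∞) g) :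
    deriv (fun x => f x * g x) = fun x => deriv f x * g x + f x * deriv g x := by
  funext x
  exact deriv_fun_mul (hf.differentiable (by simp) x) (hg.differentiable (by simp) x)

theorem deriv_comp_of_contDiff {f g : ℝ → ℝ} (hf : ContDiff ℝ (⊤ : ℕ∞) f)
    (hg : ContDiff ℝ (⊤ : ℕ∞) g) :
    deriv (fun x => f (g x)) = fun x => deriv f (g x) * deriv g x := by
  funext x
  exact ((hf.differentiable (by simp) (g x)).hasDerivAt.comp x
    (hg.differentiable (by simp) x).hasDerivAt).deriv

theorem PolyGrowth.mul (hq : Tendsto q atTop atTop) (hφ : ∀ j, ContDiff ℝ (⊤ : ℕ∞) (φ j))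
    (hψ : ∀ j, ContDiff ℝ (⊤ : ℕ∞) (ψ j)) (h : PolyGrowth q m φ) (h' : PolyGrowth q m ψ) :
    PolyGrowth q m (fun j x => φ j x * ψ j x) := by
  have base : ∀ {φ ψ : ℕ → ℝ → ℝ}, PolyGrowth q 0 φ → PolyGrowth q 0 ψ →
      PolyGrowth q 0 (fun j x => φ j x * ψ j x) := by
    intro φ ψ h h'
    rw [polyGrowth_zero] at h h' ⊢
    obtain ⟨P, hP⟩ := h
    obtain ⟨P', hP'⟩ := h'
    refine ⟨P + P', ?_⟩
    filter_upwards [hP, hP'] with j h1 h2 x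
    rw [abs_mul, pow_add]
    exact mul_le_mul (h1 x) (h2 x) (abs_nonneg _) ((abs_nonneg _).trans (h1 x))
  induction m generalizing φ ψ with
  | zero => exact base h h'
  | succ m ih =>
    obtain ⟨h0, h1⟩ := polyGrowth_succ.1 h
    obtain ⟨h0', h1'⟩ := polyGrowth_succ.1 h'
    refine polyGrowth_succ.2 ⟨base h0 h0', ?_⟩
    simp_rw [fun j => deriv_mul_of_contDiff (hφ j) (hψ j)]
    have hφ' := fun j => contDiff_deriv_of_contDiff (hφ j)
    have hψ' := fun j => contDiff_deriv_of_contDiff (hψ j)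
    exact .add hq (fun j => (hφ' j).mul (hψ j)) (fun j => (hφ j).mul (hψ' j))
      (ih hφ' hψ h1 (h'.mono m.le_succ)) (ih hφ hψ' (h.mono m.le_succ) h1')

theorem RapidDecay.mul (hq : Tendsto q atTop atTop) (hφ : ∀ j, ContDiff ℝ (⊤ : ℕ∞) (φ j))
    (hψ : ∀ j, ContDiff ℝ (⊤ : ℕ∞) (ψ j)) (h : RapidDecay q m φ) (h' : PolyGrowth q m ψ) :
    RapidDecay q m (fun j x => φ j x * ψ j x) := by
  have base : ∀ {φ ψ : ℕ → ℝ → ℝ}, RapidDecay q 0 φ → PolyGrowth q 0 ψ →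
      RapidDecay q 0 (fun j x => φ j x * ψ j x) := by
    intro φ ψ h h'
    rw [rapidDecay_zero] at h ⊢
    obtain ⟨P', hP'⟩ := polyGrowth_zero.1 h'
    intro P
    filter_upwards [h (P' + P), hP', hq.eventually_ge_atTop 0] with j h1 h2 h3 x
    refine le_trans ?_ (h1 x)
    rw [abs_mul, pow_add, mul_assoc]
    have := h2 x
    gcongr
  induction m generalizing φ ψ with
  | zero => exact base h h'
  | succ m ih =>
    obtain ⟨h0, h1⟩ := rapidDecay_succ.1 h
    obtain ⟨h0', h1'⟩ := polyGrowth_succ.1 h'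
    refine rapidDecay_succ.2 ⟨base h0 h0', ?_⟩
    simp_rw [fun j => deriv_mul_of_contDiff (hφ j) (hψ j)]
    have hφ' := fun j => contDiff_deriv_of_contDiff (hφ j)
    have hψ' := fun j => contDiff_deriv_of_contDiff (hψ j)
    exact .add hq (fun j => (hφ' j).mul (hψ j)) (fun j => (hφ j).mul (hψ' j))
      (ih hφ' hψ h1 (h'.mono m.le_succ)) (ih hφ hψ' (h.mono m.le_succ) h1')

theorem polyGrowth_const (hq : Tendsto q atTop atTop) {f : ℝ → ℝ}
    (hf : ContDiff ℝ (⊤ : ℕ∞) f) (hp : Function.Periodic f 1) (m : ℕ) :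
    PolyGrowth q m (fun _ => f) := by
  have base : ∀ {f : ℝ → ℝ}, ContDiff ℝ (⊤ : ℕ∞) f → Function.Periodic f 1 →
      PolyGrowth q 0 (fun _ => f) := by
    intro f hf hp
    obtain ⟨C, -, h⟩ := abs_le_of_continuous_of_periodic hf.continuous hp
    refine polyGrowth_zero.2 ⟨1, ?_⟩
    filter_upwards [hq.eventually_ge_atTop C] with j hj x
    rw [pow_one]
    exact (h x).trans hj
  induction m generalizing f with
  | zero => exact base hf hp
  | succ m ih =>
    refine polyGrowth_succ.2 ⟨base hf hp, ih (contDiff_deriv_of_contDiff hf) fun x => ?_⟩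
    rw [← deriv_comp_add_const, funext hp]

theorem periodic_deriv {f : ℝ → ℝ} (hp : Function.Periodic f 1) :
    Function.Periodic (deriv f) 1 := fun x => by
  rw [← deriv_comp_add_const, funext hp]

theorem PolyGrowth.comp (hq : Tendsto q atTop atTop) {f : ℝ → ℝ}
    (hf : ContDiff ℝ (⊤ : ℕ∞) f) (hp : Function.Periodic f 1)
    (hφ : ∀ j, ContDiff ℝ (⊤ : ℕ∞) (φ j)) (h : ∀ m, PolyGrowth q m (fun j => deriv (φ j)))
    (m : ℕ) : PolyGrowth q m (fun j x => f (φ j x)) := by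
  have base : ∀ {f : ℝ → ℝ}, ContDiff ℝ (⊤ : ℕ∞) f → Function.Periodic f 1 →
      PolyGrowth q 0 (fun j x => f (φ j x)) := by
    intro f hf hp
    obtain ⟨P, hP⟩ := polyGrowth_zero.1 (polyGrowth_const hq hf hp 0)
    refine polyGrowth_zero.2 ⟨P, ?_⟩
    filter_upwards [hP] with j hj x using hj _
  induction m generalizing f with
  | zero => exact base hf hp
  | succ m ih =>
    refine polyGrowth_succ.2 ⟨base hf hp, ?_⟩
    simp_rw [fun j => deriv_comp_of_contDiff hf (hφ j)]
    have hf' := contDiff_deriv_of_contDiff hf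
    exact .mul hq (fun j => hf'.comp (hφ j)) (fun j => contDiff_deriv_of_contDiff (hφ j))
      (ih hf' (periodic_deriv hp)) (h m)

theorem RapidDecay.comp (hq : Tendsto q atTop atTop) {k : ℝ → ℝ}
    (hk : ContDiff ℝ (⊤ : ℕ∞) k) (hp : Function.Periodic (deriv k) 1)
    (hφ : ∀ j, ContDiff ℝ (⊤ : ℕ∞) (φ j)) (h : RapidDecay q m φ) :
    RapidDecay q m (fun j x => φ j (k x)) := by
  have base : ∀ {φ : ℕ → ℝ → ℝ}, RapidDecay q 0 φ → RapidDecay q 0 (fun j x => φ j (k x)) := by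
    intro φ h
    rw [rapidDecay_zero] at h ⊢
    intro P
    filter_upwards [h P] with j hj x using hj _
  induction m generalizing φ with
  | zero => exact base h
  | succ m ih =>
    obtain ⟨h0, h1⟩ := rapidDecay_succ.1 h
    refine rapidDecay_succ.2 ⟨base h0, ?_⟩
    simp_rw [fun j => deriv_comp_of_contDiff (hφ j) hk]
    have hφ' := fun j => contDiff_deriv_of_contDiff (hφ j)
    have hk' := contDiff_deriv_of_contDiff hk
    exact .mul hq (fun j => (hφ' j).comp hk) (fun _ => hk') (ih hφ' h1)
      (polyGrowth_const hq hk' hp m)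

/-- A rapidly decreasing perturbation of the inner function changes a composition by a rapidly
decreasing family. -/
theorem RapidDecay.comp_add_sub_comp (hq : Tendsto q atTop atTop) {f : ℝ → ℝ}
    (hf : ContDiff ℝ (⊤ : ℕ∞) f) (hp : Function.Periodic (deriv f) 1) {b e : ℕ → ℝ → ℝ}
    (hb : ∀ j, ContDiff ℝ (⊤ : ℕ∞) (b j)) (he : ∀ j, ContDiff ℝ (⊤ : ℕ∞) (e j))
    (hb' : ∀ m, PolyGrowth q m (fun j => deriv (b j))) (he' : ∀ m, RapidDecay q m e) (m : ℕ) :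
    RapidDecay q m (fun j x => f (b j x + e j x) - f (b j x)) := by
  have base : ∀ {f : ℝ → ℝ}, ContDiff ℝ (⊤ : ℕ∞) f → Function.Periodic (deriv f) 1 →
      RapidDecay q 0 (fun j x => f (b j x + e j x) - f (b j x)) := by
    intro f hf hp
    obtain ⟨C, hC, h⟩ := abs_le_of_continuous_of_periodic
      (contDiff_deriv_of_contDiff hf).continuous hp
    refine rapidDecay_zero.2 fun P => ?_
    filter_upwards [rapidDecay_zero.1 (he' 0) (P + 1), hq.eventually_ge_atTop C] with j h1 h2 x
    have h3 := Convex.norm_image_sub_le_of_norm_deriv_le (s := Set.univ) (C := C)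
      (fun x _ => hf.differentiable (by simp) x) (fun x _ => h x) convex_univ
      (Set.mem_univ (b j x)) (Set.mem_univ (b j x + e j x))
    rw [add_sub_cancel_left, Real.norm_eq_abs, Real.norm_eq_abs] at h3
    have hq0 : 0 < q j := hC.trans_le h2
    calc |f (b j x + e j x) - f (b j x)| * q j ^ P ≤ (C * |e j x|) * q j ^ P := by gcongr
      _ ≤ (q j * |e j x|) * q j ^ P := by gcongr
      _ = |e j x| * q j ^ (P + 1) := by ring
      _ ≤ 1 := h1 x
  induction m generalizing f with
  | zero => exact base hf hp
  | succ m ih =>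
    refine rapidDecay_succ.2 ⟨base hf hp, ?_⟩
    have hf' := contDiff_deriv_of_contDiff hf
    have hb1 := fun j => contDiff_deriv_of_contDiff (hb j)
    have he1 := fun j => contDiff_deriv_of_contDiff (he j)
    have hd : (fun j => deriv (fun x => f (b j x + e j x) - f (b j x))) = fun j x =>
        (deriv f (b j x + e j x) - deriv f (b j x)) * (deriv (b j) x + deriv (e j) x)
          + deriv (e j) x * deriv f (b j x) := by
      funext j x
      have d1 := (hb j).differentiable (by simp) x
      have d2 := (he j).differentiable (by simp) x
      have d3 := (hf.differentiable (by simp) (b j x + e j x)).hasDerivAt.comp x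
        (d1.hasDerivAt.add d2.hasDerivAt)
      have d4 := (hf.differentiable (by simp) (b j x)).hasDerivAt.comp x d1.hasDerivAt
      refine (d3.sub d4).deriv.trans ?_
      ring
    rw [hd]
    have he2 : RapidDecay q m (fun j => deriv (e j)) := (rapidDecay_succ.1 (he' (m + 1))).2
    have hep : PolyGrowth q m (fun j => deriv (e j)) := by
      intro i hi
      refine ⟨0, ?_⟩
      filter_upwards [he2 i hi 0] with j hj x
      simpa using hj x
    have c1 : ∀ j, ContDiff ℝ (⊤ : ℕ∞) fun x => deriv f (b j x + e j x) - deriv f (b j x) :=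
      fun j => (hf'.comp ((hb j).add (he j))).sub (hf'.comp (hb j))
    have c2 : ∀ j, ContDiff ℝ (⊤ : ℕ∞) fun x => deriv (b j) x + deriv (e j) x :=
      fun j => (hb1 j).add (he1 j)
    have c3 : ∀ j, ContDiff ℝ (⊤ : ℕ∞) fun x => deriv f (b j x) := fun j => hf'.comp (hb j)
    exact .add hq (fun j => (c1 j).mul (c2 j)) (fun j => (he1 j).mul (c3 j))
      (.mul hq c1 c2 (ih hf' (periodic_deriv hp)) (.add hq hb1 he1 (hb' m) hep))
      (.mul hq he1 c3 he2 (.comp hq hf' hp hb hb' m))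

end Families

/-- If `p j / q j` approximates `a` faster than any power of `q j`, then conjugating the rotation by
`a` by the `q j`-fold cover of a fixed diffeomorphism is a small perturbation. -/
theorem rapidDecay_conj_cover {h k g l : ℝ → ℝ} (hk : LiftPair h k) (gl : LiftPair g l) {a : ℝ}
    {p : ℕ → ℤ} {q : ℕ → ℕ} (hq : Tendsto q atTop atTop) (hq0 : ∀ j, 0 < q j)
    (hpq : ∀ j, |a - p j / q j| ≤ 1 / (q j : ℝ) ^ j) (m : ℕ) :
    RapidDecay (fun j => (q j : ℝ)) m (fun j x =>
      h (g (q j * (l (q j * k x) / q j + a)) / q j) - h (k x + a)) := by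
  have hqr : Tendsto (fun j => (q j : ℝ)) atTop atTop := tendsto_natCast_atTop_atTop.comp hq
  have hqr0 : ∀ j, (0 : ℝ) < q j := fun j => mod_cast hq0 j
  have cst : ∀ (c : ℕ → ℝ), (∀ P : ℕ, ∀ᶠ j in atTop, |c j| * (q j : ℝ) ^ P ≤ 1) →
      ∀ m, RapidDecay (fun j => (q j : ℝ)) m (fun j _ => c j) := by
    intro c hc m
    cases m with
    | zero => exact rapidDecay_zero.2 fun P => (hc P).mono fun j hj _ => hj
    | succ m =>
      refine rapidDecay_succ.2
        ⟨rapidDecay_zero.2 fun P => (hc P).mono fun j hj _ => hj, fun i _ P => ?_⟩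
      refine .of_forall fun j x => ?_
      simp only [deriv_const']
      rw [iteratedDeriv_const]
      simp
  have hβ : ∀ P : ℕ, ∀ᶠ j in atTop, |a - p j / q j| * (q j : ℝ) ^ P ≤ 1 := by
    intro P
    filter_upwards [eventually_ge_atTop P] with j hj
    calc |a - p j / q j| * (q j : ℝ) ^ P ≤ 1 / (q j : ℝ) ^ j * (q j : ℝ) ^ j := by
          have : (1 : ℝ) ≤ q j := mod_cast hq0 j
          gcongr
          exact hpq j
      _ = 1 := by
          have := (hqr0 j).ne'
          field_simp
  set β : ℕ → ℝ := fun j => a - p j / q j with hβdef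
  have hε : ∀ m, RapidDecay (fun j => (q j : ℝ)) m (fun j _ => (q j : ℝ) * β j) := by
    refine cst _ fun P => (hβ (P + 1)).mono fun j hj => ?_
    rw [abs_mul, abs_of_pos (hqr0 j)]
    rw [pow_succ] at hj
    linarith
  have hl : ∀ j, ContDiff ℝ (⊤ : ℕ∞) (fun x => l (q j * x)) := fun j =>
    gl.smooth_inv.comp (contDiff_const.mul contDiff_id)
  have hlin : ∀ m, PolyGrowth (fun j => (q j : ℝ)) m (fun j _ => (q j : ℝ)) := by
    intro m i _
    refine ⟨1, .of_forall fun j x => ?_⟩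
    rw [iteratedDeriv_const]
    split_ifs <;> simp
  have hl' : ∀ m, PolyGrowth (fun j => (q j : ℝ)) m (fun j => deriv fun x => l (q j * x)) := by
    intro m
    have e : ∀ j, deriv (fun x => l (q j * x)) = fun x => deriv l (q j * x) * q j := by
      intro j
      rw [deriv_comp_of_contDiff (g := fun x => (q j : ℝ) * x) gl.smooth_inv
        (contDiff_const.mul contDiff_id)]
      funext x
      rw [deriv_const_mul_field, deriv_id'', mul_one]
    simp_rw [e]
    refine .mul hqr (fun j => gl.symm.contDiff_deriv.comp (contDiff_const.mul contDiff_id))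
      (fun j => contDiff_const) ?_ (hlin m)
    refine .comp hqr gl.symm.contDiff_deriv gl.symm.deriv_periodic
      (fun j => contDiff_const.mul contDiff_id) (fun m => ?_) m
    have e' : ∀ j, deriv (fun x : ℝ => (q j : ℝ) * x) = fun _ => (q j : ℝ) := fun j => by
      funext x
      rw [deriv_const_mul_field, deriv_id'', mul_one]
    exact (funext e' : (fun j => deriv fun x : ℝ => (q j : ℝ) * x) = _) ▸ hlin m
  have hE := RapidDecay.comp_add_sub_comp hqr gl.smooth gl.deriv_periodic hl
    (fun j => contDiff_const (c := (q j : ℝ) * β j)) hl' hε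
  have smE : ∀ j, ContDiff ℝ (⊤ : ℕ∞)
      fun x => g (l (q j * x) + q j * β j) - g (l (q j * x)) := fun j =>
    (gl.smooth.comp ((hl j).add contDiff_const)).sub (gl.smooth.comp (hl j))
  have hinv : ∀ m, PolyGrowth (fun j => (q j : ℝ)) m (fun j _ => 1 / (q j : ℝ)) := by
    intro m i _
    refine ⟨0, .of_forall fun j x => ?_⟩
    rw [iteratedDeriv_const]
    have : (1 : ℝ) ≤ q j := mod_cast hq0 j
    split_ifs
    · rw [abs_of_pos (by positivity), pow_zero]
      exact (div_le_one (hqr0 j)).2 this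
    · simp
  set e : ℕ → ℝ → ℝ := fun j x =>
    (g (l (q j * x) + q j * β j) - g (l (q j * x))) * (1 / q j) + -β j with hedef
  have sme : ∀ j, ContDiff ℝ (⊤ : ℕ∞) (e j) := fun j =>
    ((smE j).mul contDiff_const).add contDiff_const
  have he : ∀ m, RapidDecay (fun j => (q j : ℝ)) m e := fun m => by
    refine .add hqr (fun j => (smE j).mul contDiff_const) (fun j => contDiff_const)
      (.mul hqr smE (fun j => contDiff_const) (hE m) (hinv m))
      (cst _ ?_ m)
    simpa only [abs_neg] using hβ
  have key := RapidDecay.comp_add_sub_comp hqr hk.smooth hk.deriv_periodic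
    (b := fun _ x => x + a) (fun j => contDiff_id.add contDiff_const) sme
    (fun m => by
      have : deriv (fun x => x + a) = fun _ => 1 := by
        funext x
        simp
      rw [this]
      exact polyGrowth_const hqr contDiff_const (fun _ => rfl) m) he m
  have := RapidDecay.comp hqr hk.smooth_inv hk.symm.deriv_periodic (fun j =>
    (hk.smooth.comp ((contDiff_id.add contDiff_const).add (sme j))).sub
      (hk.smooth.comp (contDiff_id.add contDiff_const))) key
  refine (congrArg (RapidDecay _ m) (funext fun j => funext fun x => ?_)).mp this
  have hj := (hqr0 j).ne'
  simp only [hedef, Function.comp_apply, id]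
  congr 2
  rw [gl.apply_inv]
  have e1 : (q j : ℝ) * (l (q j * k x) / q j + a) = l (q j * k x) + q j * β j + p j := by
    simp only [hβdef]
    field_simp
    ring
  rw [e1, add_intCast_of_add_one gl.add_one]
  simp only [hβdef]
  field_simp
  ring

theorem RapidDecay.eventually_le {q : ℕ → ℝ} {m : ℕ} {φ : ℕ → ℝ → ℝ}
    (hq : Tendsto q atTop atTop) (h : RapidDecay q m φ) {δ : ℝ} (hδ : 0 < δ) :
    ∀ᶠ j in atTop, ∀ i ≤ m, ∀ x, |iteratedDeriv i (φ j) x| ≤ δ := by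
  have h1 : ∀ i ∈ Finset.range (m + 1), ∀ᶠ j in atTop, ∀ x, |iteratedDeriv i (φ j) x| ≤ δ := by
    intro i hi
    filter_upwards [h i (Finset.mem_range_succ_iff.1 hi) 1, hq.eventually_ge_atTop (1 / δ)]
      with j h1 h2 x
    have h3 := h1 x
    rw [pow_one] at h3
    have h4 : 1 ≤ δ * q j := by
      rw [div_le_iff₀ hδ] at h2
      linarith
    have h5 : 0 < q j := (by positivity : (0 : ℝ) < 1 / δ).trans_le h2
    exact le_of_mul_le_mul_right (h3.trans h4) h5
  filter_upwards [(Filter.eventually_all_finset _).2 h1] with j hj i hi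
  exact hj i (Finset.mem_range_succ_iff.2 hi)

theorem Liouville.exists_seq {α : ℝ} (hL : Liouville α) :
    ∃ (p : ℕ → ℤ) (q : ℕ → ℕ), Tendsto q atTop atTop ∧ (∀ j, 0 < q j) ∧
      ∀ j, |α - p j / q j| ≤ 1 / (q j : ℝ) ^ j := by
  have h : ∀ j : ℕ, ∃ (b : ℕ) (a : ℤ), j + 1 ≤ b ∧ |α - a / b| ≤ 1 / (b : ℝ) ^ j := by
    intro j
    obtain ⟨b, ⟨a, -, h1⟩, h2⟩ :=
      ((hL.frequently_exists_num j).and_eventually (eventually_ge_atTop (j + 1))).exists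
    exact ⟨b, a, h2, h1.le⟩
  choose q p hq hp using h
  refine ⟨p, q, tendsto_atTop_mono (fun j => ?_) tendsto_id, fun j => ?_, hp⟩
  · exact (Nat.le_succ j).trans (hq j)
  · have := hq j
    omega

/-! ### The profile of a step -/

theorem periodic_sin_two_pi : Function.Periodic (fun y : ℝ => Real.sin (2 * Real.pi * y)) 1 :=
  fun y => by
    show Real.sin (2 * Real.pi * (y + 1)) = _
    rw [mul_add, mul_one, Real.sin_add_two_pi]

theorem exists_volume_abs_sin_lt_le {η : ℝ} (hη : 0 < η) :
    ∃ c : ℝ, 0 < c ∧ c ≤ 1 / 2 ∧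
      volume ({y : ℝ | |Real.sin (2 * Real.pi * y)| < c} ∩ Set.Ioc 0 1) ≤ ENNReal.ofReal η := by
  let S : ℕ → Set ℝ := fun m =>
    {y : ℝ | |Real.sin (2 * Real.pi * y)| < 1 / ((m : ℝ) + 2)} ∩ Set.Ioc 0 1
  have hmeas : ∀ m, MeasurableSet (S m) := fun m =>
    (measurableSet_lt (by fun_prop) measurable_const).inter measurableSet_Ioc
  have hanti : Antitone S := by
    intro a b hab y hy
    have h1 : |Real.sin (2 * Real.pi * y)| < 1 / ((b : ℝ) + 2) := hy.1
    have h2 : (a : ℝ) ≤ b := mod_cast hab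
    have h3 : 1 / ((b : ℝ) + 2) ≤ 1 / ((a : ℝ) + 2) := by gcongr
    exact ⟨h1.trans_le h3, hy.2⟩
  have hcount : (⋂ m, S m).Countable := by
    refine (Set.countable_range fun n : ℤ => (n : ℝ) / 2).mono fun y hy => ?_
    have h0 : Real.sin (2 * Real.pi * y) = 0 := by
      by_contra hne
      obtain ⟨m, hm⟩ := exists_nat_one_div_lt (abs_pos.2 hne)
      have h1 : |Real.sin (2 * Real.pi * y)| < 1 / ((m : ℝ) + 2) := (Set.mem_iInter.1 hy m).1
      have h2 : 1 / ((m : ℝ) + 2) ≤ 1 / ((m : ℝ) + 1) := by gcongr; norm_num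
      linarith
    obtain ⟨n, hn⟩ := Real.sin_eq_zero_iff.1 h0
    refine ⟨n, ?_⟩
    have := Real.pi_pos.ne'
    have h1 : (n : ℝ) = 2 * y := by
      apply mul_right_cancel₀ this
      linarith
    simp only [h1]
    ring
  have hlim := tendsto_measure_iInter_atTop (μ := volume) (fun m => (hmeas m).nullMeasurableSet)
    hanti ⟨0, ne_top_of_le_ne_top (by simp : volume (Set.Ioc (0 : ℝ) 1) ≠ ⊤)
      (measure_mono Set.inter_subset_right)⟩
  rw [hcount.measure_zero] at hlim
  obtain ⟨m, hm⟩ := (hlim.eventually (ge_mem_nhds (ENNReal.ofReal_pos.2 hη))).exists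
  refine ⟨1 / ((m : ℝ) + 2), by positivity, ?_, hm⟩
  gcongr
  have : (0 : ℝ) ≤ m := m.cast_nonneg
  linarith

/-- A circle diffeomorphism whose derivative takes mostly two values, with ratio `M`. -/
theorem exists_profile {M η : ℝ} (hM : 1 < M) (hη : 0 < η) :
    ∃ (Q G : ℝ → ℝ) (s c : ℝ), LiftPair Q G ∧ 0 < s ∧
      (∀ y, 1 / 2 ≤ Real.sin (2 * Real.pi * y) → deriv Q y = s) ∧
      (∀ y, Real.sin (2 * Real.pi * y) ≤ -(1 / 2) → deriv Q y = s / M) ∧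
      (∀ y, c ≤ |Real.sin (2 * Real.pi * y)| → deriv Q y = s ∨ deriv Q y = s / M) ∧
      volume ({y : ℝ | |Real.sin (2 * Real.pi * y)| < c} ∩ Set.Ioc 0 1) ≤ ENNReal.ofReal η := by
  obtain ⟨c, hc0, hc1, hvol⟩ := exists_volume_abs_sin_lt_le hη
  let σ : ℝ → ℝ := fun y => Real.sin (2 * Real.pi * y)
  have hσ : ContDiff ℝ (⊤ : ℕ∞) σ := Real.contDiff_sin.comp (contDiff_const.mul contDiff_id)
  let φ : ℝ → ℝ := fun y => Real.smoothTransition (1 / (2 * c) * σ y + 1 / 2)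
  have hφ1 : ∀ y, c ≤ σ y → φ y = 1 := fun y hy => by
    refine Real.smoothTransition.one_of_one_le ?_
    have : 1 / (2 * c) * c ≤ 1 / (2 * c) * σ y := by gcongr
    rw [show 1 / (2 * c) * c = 1 / 2 by field_simp] at this
    linarith
  have hφ0 : ∀ y, σ y ≤ -c → φ y = 0 := fun y hy => by
    refine Real.smoothTransition.zero_of_nonpos ?_
    have : 1 / (2 * c) * σ y ≤ 1 / (2 * c) * (-c) := by gcongr
    rw [show 1 / (2 * c) * (-c) = -(1 / 2) by field_simp] at this
    linarith
  let ρ : ℝ → ℝ := fun y => φ y + (1 - φ y) / M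
  have hφs : ContDiff ℝ (⊤ : ℕ∞) φ :=
    Real.smoothTransition.contDiff.comp ((contDiff_const.mul hσ).add contDiff_const)
  have hρs : ContDiff ℝ (⊤ : ℕ∞) ρ := hφs.add ((contDiff_const.sub hφs).div_const _)
  have hρpos : ∀ y, 0 < ρ y := fun y => by
    have h0 : 0 ≤ φ y := Real.smoothTransition.nonneg _
    have h1 : φ y ≤ 1 := Real.smoothTransition.le_one _
    have hM0 : 0 < M := one_pos.trans hM
    rcases h0.eq_or_lt with h | h
    · simp only [ρ, ← h]
      positivity
    · exact add_pos_of_pos_of_nonneg h (div_nonneg (by linarith) hM0.le)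
  have hρp : Function.Periodic ρ 1 := fun y => by
    simp only [ρ, φ, σ, periodic_sin_two_pi y]
  set I := ∫ y in (0 : ℝ)..1, ρ y with hI
  have hIpos : 0 < I := intervalIntegral.intervalIntegral_pos_of_pos
    (hρs.continuous.intervalIntegrable _ _) hρpos one_pos
  let Q : ℝ → ℝ := fun x => I⁻¹ * ∫ y in (0 : ℝ)..x, ρ y
  have hQ : ∀ x, HasDerivAt Q (I⁻¹ * ρ x) x := fun x =>
    (intervalIntegral.integral_hasDerivAt_right (hρs.continuous.intervalIntegrable _ _)
      (hρs.continuous.stronglyMeasurableAtFilter _ _) hρs.continuous.continuousAt).const_mul _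
  have hQ' : deriv Q = fun x => I⁻¹ * ρ x := funext fun x => (hQ x).deriv
  have hQs : ContDiff ℝ (⊤ : ℕ∞) Q := by
    refine contDiff_infty_iff_deriv.2 ⟨fun x => (hQ x).differentiableAt, ?_⟩
    rw [hQ']
    exact contDiff_const.mul hρs
  have hQ1 : ∀ x, Q (x + 1) = Q x + 1 := fun x => by
    simp only [Q]
    rw [← intervalIntegral.integral_add_adjacent_intervals
      (hρs.continuous.intervalIntegrable 0 x) (hρs.continuous.intervalIntegrable x (x + 1)),
      hρp.intervalIntegral_add_eq x 0, zero_add, mul_add, ← hI, inv_mul_cancel₀ hIpos.ne']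
  obtain ⟨G, hG⟩ := exists_liftPair hQs hQ1 fun x => by
    rw [hQ']
    exact mul_pos (inv_pos.2 hIpos) (hρpos x)
  have v1 : ∀ y, c ≤ σ y → deriv Q y = I⁻¹ := fun y hy => by
    simp [hQ', ρ, hφ1 y hy]
  have v0 : ∀ y, σ y ≤ -c → deriv Q y = I⁻¹ / M := fun y hy => by
    simp [hQ', ρ, hφ0 y hy, div_eq_mul_inv]
  refine ⟨Q, G, I⁻¹, c, hG, inv_pos.2 hIpos, fun y hy => v1 y (hc1.trans hy),
    fun y hy => v0 y (hy.trans (by linarith)), fun y hy => ?_, hvol⟩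
  rcases le_abs'.1 hy with h | h
  · exact .inr (v0 y h)
  · exact .inl (v1 y h)

theorem volume_inter_Ioc_add_nat_le {S : Set ℝ} (hS : MeasurableSet S)
    (hp : ∀ x, x + 1 ∈ S ↔ x ∈ S) (a : ℝ) (q : ℕ) :
    volume (S ∩ Set.Ioc a (a + q)) ≤ q * volume (S ∩ Set.Ioc 0 1) := by
  have hz : ∀ (m : ℤ) (x : ℝ), x + m ∈ S ↔ x ∈ S := fun m x => by
    have : Function.Periodic (fun x => x ∈ S) 1 := fun x => propext (hp x)
    simpa using this.int_mul m x
  have hone : ∀ b : ℝ, volume (S ∩ Set.Ioc b (b + 1)) = volume (S ∩ Set.Ioc 0 1) := by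
    intro b
    have h1 := (isAddFundamentalDomain_Ioc (T := (1 : ℝ)) one_pos b volume).measure_set_eq
      (isAddFundamentalDomain_Ioc (T := (1 : ℝ)) one_pos 0 volume) hS (fun g => by
        ext x
        obtain ⟨m, hm⟩ := AddSubgroup.mem_zmultiples_iff.1 g.2
        have hg : (g : ℝ) = m := by simpa using hm.symm
        show (g : ℝ) + x ∈ S ↔ x ∈ S
        rw [hg, add_comm, hz])
    simpa using h1
  induction q with
  | zero => simp
  | succ q ih =>
    have : S ∩ Set.Ioc a (a + (q + 1 : ℕ)) ⊆
        (S ∩ Set.Ioc a (a + q)) ∪ (S ∩ Set.Ioc (a + q) (a + q + 1)) := by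
      rintro x ⟨hx, h1, h2⟩
      push_cast at h2
      rcases le_or_gt x (a + q) with h | h
      · exact .inl ⟨hx, h1, h⟩
      · exact .inr ⟨hx, h, by linarith⟩
    refine (measure_mono this).trans ((measure_union_le _ _).trans ?_)
    rw [hone]
    push_cast
    rw [add_mul, one_mul]
    gcongr

/-! ### One step of the construction -/

theorem LiftPair.exists_lipschitzWith {h k : ℝ → ℝ} (p : LiftPair h k) :
    ∃ K : NNReal, 0 < K ∧ LipschitzWith K h := by
  obtain ⟨C, hC, h1⟩ := abs_le_of_continuous_of_periodic p.continuous_deriv p.deriv_periodic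
  refine ⟨⟨C, hC.le⟩, hC, lipschitzWith_of_nnnorm_deriv_le p.differentiable fun x => ?_⟩
  exact h1 x

/-- Away from a small exceptional set `T`, the function `w'` is the product of `w` by `s` or by
`s / M`, where `M` is huge compared to the oscillation of `w`; both possibilities occur on a
definite proportion of some interval of size at most `δ` around every point. -/
structure IsStep (n : ℕ) (δ : ℝ) (w w' : ℝ → ℝ) (s M : ℝ) (T : Set ℝ) : Prop where
  pos : 0 < s
  two_le : 2 ≤ M
  mul_le_mul : ∀ x y, (n + 1) * w x ≤ M * w y
  measurableSet : MeasurableSet T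
  add_one_mem : ∀ x, x + 1 ∈ T ↔ x ∈ T
  volume_le : volume (T ∩ Set.Ioc 0 1) ≤ ENNReal.ofReal ((1 / 2) ^ n)
  eq_or_eq : ∀ x ∉ T, w' x = s * w x ∨ w' x = s / M * w x
  exists_closedBall : ∀ x, ∃ c ρ : ℝ, 0 < ρ ∧ ρ ≤ δ ∧ x ∈ Metric.closedBall c ρ ∧
    ENNReal.ofReal (ρ / 3) ≤ volume (Metric.closedBall c ρ ∩ {y | w' y = s * w y}) ∧
    ENNReal.ofReal (ρ / 3) ≤ volume (Metric.closedBall c ρ ∩ {y | w' y = s / M * w y})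

theorem sin_two_pi_mul_ge {y : ℝ} (m : ℤ) (h1 : m + 1 / 12 ≤ y) (h2 : y ≤ m + 5 / 12) :
    1 / 2 ≤ Real.sin (2 * Real.pi * y) := by
  have hp := periodic_sin_two_pi.sub_int_mul_eq (x := y) m
  simp only [mul_one] at hp
  rw [← hp]
  have hpi := Real.pi_pos
  rw [← Real.cos_sub_pi_div_two, ← Real.cos_abs, ← Real.cos_pi_div_three]
  refine Real.cos_le_cos_of_nonneg_of_le_pi (abs_nonneg _) (by linarith) ?_
  rw [abs_le]
  constructor <;> nlinarith

theorem sin_two_pi_mul_le {y : ℝ} (m : ℤ) (h1 : m + 7 / 12 ≤ y) (h2 : y ≤ m + 11 / 12) :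
    Real.sin (2 * Real.pi * y) ≤ -(1 / 2) := by
  have := sin_two_pi_mul_ge (y := y - 1 / 2) m (by linarith) (by linarith)
  rw [show 2 * Real.pi * (y - 1 / 2) = 2 * Real.pi * y - Real.pi by ring, Real.sin_sub_pi] at this
  linarith

theorem LiftPair.volume_preimage_le {h k : ℝ → ℝ} (p : LiftPair h k) {K : NNReal}
    (hK : LipschitzWith K h) {S : Set ℝ} (hS : MeasurableSet S)
    (hp : ∀ x, x + 1 ∈ S ↔ x ∈ S) {q : ℕ} (hq : 0 < q) :
    volume ({x | q * k x ∈ S} ∩ Set.Ioc 0 1) ≤ K * volume (S ∩ Set.Ioc 0 1) := by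
  have hq' : (0 : ℝ) < q := by exact_mod_cast hq
  have hsub : {x | q * k x ∈ S} ∩ Set.Ioc 0 1 ⊆
      h '' ((fun y => (q : ℝ) * y) ⁻¹' (S ∩ Set.Ioc (q * k 0) (q * k 0 + q))) := by
    rintro x ⟨hx, h0, h1⟩
    refine ⟨k x, ⟨hx, ?_, ?_⟩, p.apply_inv x⟩
    · exact mul_lt_mul_of_pos_left (p.symm.strictMono h0) hq'
    · have h2 := p.symm.strictMono.monotone h1
      have h3 := p.add_one_inv 0
      rw [zero_add] at h3
      show (q : ℝ) * k x ≤ _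
      nlinarith
  have himg : ∀ U : Set ℝ, volume (h '' U) ≤ K * volume U := fun U => by
    have := hK.hausdorffMeasure_image_le (d := 1) zero_le_one U
    simpa [MeasureTheory.hausdorffMeasure_real] using this
  refine (measure_mono hsub).trans ((himg _).trans (mul_le_mul_right ?_ _))
  rw [Real.volume_preimage_mul_left hq'.ne', abs_of_pos (inv_pos.2 hq')]
  calc ENNReal.ofReal (q : ℝ)⁻¹ * volume (S ∩ Set.Ioc (q * k 0) (q * k 0 + q))
      ≤ ENNReal.ofReal (q : ℝ)⁻¹ * (q * volume (S ∩ Set.Ioc 0 1)) := by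
        gcongr
        exact volume_inter_Ioc_add_nat_le hS hp _ q
    _ = volume (S ∩ Set.Ioc 0 1) := by
        rw [← mul_assoc, ← ENNReal.ofReal_natCast q, ← ENNReal.ofReal_mul (by positivity),
          inv_mul_cancel₀ hq'.ne', ENNReal.ofReal_one, one_mul]

theorem LiftPair.exists_closedBall {h k : ℝ → ℝ} (p : LiftPair h k) {K : NNReal}
    (hK : LipschitzWith K h) {q : ℕ} (hq : 0 < q)
    (hosc : ∀ a b, |a - b| ≤ 1 / (q : ℝ) → |deriv h a / deriv h b - 1| ≤ 1 / 2) (x : ℝ) :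
    ∃ (c ρ : ℝ) (m : ℤ), 0 < ρ ∧ ρ ≤ K / q ∧ x ∈ Metric.closedBall c ρ ∧
      ∀ θ : ℝ, 0 ≤ θ → θ + 1 / 3 ≤ 1 → ENNReal.ofReal (ρ / 3) ≤
        volume (Metric.closedBall c ρ ∩ {y | m + θ ≤ q * k y ∧ q * k y ≤ m + θ + 1 / 3}) := by
  have hq' : (0 : ℝ) < q := by exact_mod_cast hq
  set m : ℤ := ⌊q * k x⌋ with hm
  have m1 : (m : ℝ) ≤ q * k x := Int.floor_le _
  have m2 : q * k x < m + 1 := Int.lt_floor_add_one _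
  have hmono := p.strictMono
  set a0 := h (m / q) with ha0
  set a1 := h ((m + 1) / q) with ha1
  have hlt : (m : ℝ) / q < (m + 1) / q := by gcongr; linarith
  have hd : a1 - a0 ≤ K / q := by
    have := hK.dist_le_mul ((m + 1) / q) (m / q)
    rw [Real.dist_eq, Real.dist_eq] at this
    refine (le_abs_self _).trans (this.trans_eq ?_)
    rw [← sub_div, add_sub_cancel_left, abs_of_pos (by positivity)]
    ring
  have ha : a0 < a1 := hmono hlt
  have hx0 : a0 ≤ x := by
    rw [← p.apply_inv x]
    refine hmono.monotone ?_
    rw [div_le_iff₀ hq']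
    linarith
  have hx1 : x ≤ a1 := by
    rw [← p.apply_inv x]
    refine hmono.monotone ?_
    rw [le_div_iff₀ hq']
    linarith
  obtain ⟨ξ, ⟨ξ0, ξ1⟩, hξ⟩ := exists_deriv_eq_slope h hlt p.smooth.continuous.continuousOn
    p.differentiable.differentiableOn
  rw [← ha0, ← ha1, ← sub_div, add_sub_cancel_left, div_div_eq_mul_div, div_one] at hξ
  refine ⟨(a0 + a1) / 2, (a1 - a0) / 2, m, by linarith, ?_, ?_, fun θ θ0 θ1 => ?_⟩
  · have : (0 : ℝ) ≤ K / q := by positivity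
    linarith
  · rw [Metric.mem_closedBall, Real.dist_eq, abs_le]
    constructor <;> linarith
  · have hlt' : (m + θ) / q < (m + θ + 1 / 3) / q := by
      gcongr ?_ / _
      linarith
    obtain ⟨ζ, ⟨ζ0, ζ1⟩, hζ⟩ := exists_deriv_eq_slope h hlt' p.smooth.continuous.continuousOn
      p.differentiable.differentiableOn
    rw [← sub_div, add_sub_cancel_left] at hζ
    have hb0 : (m : ℝ) / q ≤ (m + θ) / q := by
      gcongr ?_ / _
      linarith
    have hb1 : (m + θ + 1 / 3) / q ≤ (m + 1) / q := by gcongr ?_ / _; linarith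
    have hlen : (m + 1 : ℝ) / q = m / q + 1 / q := add_div _ _ _
    have h1 := hosc ζ ξ (by rw [abs_le]; constructor <;> linarith)
    have h2 : deriv h ξ ≤ 2 * deriv h ζ := by
      have h3 := (abs_le.1 h1).1
      have h4 : 1 / 2 ≤ deriv h ζ / deriv h ξ := by linarith
      rw [le_div_iff₀ (p.deriv_pos ξ)] at h4
      linarith
    have h5 : (a1 - a0) / 6 ≤ h ((m + θ + 1 / 3) / q) - h ((m + θ) / q) := by
      rw [hξ, hζ, div_div_eq_mul_div] at h2
      have h6 : (a1 - a0) * q ≤ (6 * (h ((m + θ + 1 / 3) / q) - h ((m + θ) / q))) * q := by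
        linarith
      linarith [le_of_mul_le_mul_right h6 hq']
    calc ENNReal.ofReal ((a1 - a0) / 2 / 3)
        ≤ volume (Set.Icc (h ((m + θ) / q)) (h ((m + θ + 1 / 3) / q))) := by
          rw [Real.volume_Icc]
          exact ENNReal.ofReal_le_ofReal (by linarith)
      _ ≤ _ := by
          refine measure_mono fun y hy => ⟨?_, ?_, ?_⟩
          · have e1 : a0 ≤ h ((m + θ) / q) := hmono.monotone hb0
            have e2 : h ((m + θ + 1 / 3) / q) ≤ a1 := hmono.monotone hb1
            rw [Metric.mem_closedBall, Real.dist_eq, abs_le]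
            constructor <;> linarith [hy.1, hy.2]
          · have := p.symm.strictMono.monotone hy.1
            rw [p.inv_apply, div_le_iff₀ hq'] at this
            linarith
          · have := p.symm.strictMono.monotone hy.2
            rw [p.inv_apply, le_div_iff₀ hq'] at this
            linarith

theorem exists_step {h k : ℝ → ℝ} (p : LiftPair h k) {α : ℝ} (hL : Liouville α) (n N : ℕ)
    {δ : ℝ} (hδ : 0 < δ) :
    ∃ h' k' : ℝ → ℝ, LiftPair h' k' ∧
      (∀ a, a = α ∨ a = -α → ∀ i ≤ N, ∀ x,
        |iteratedDeriv i (fun x => h' (k' x + a) - h (k x + a)) x| ≤ δ) ∧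
      (∀ x, |h' x - h x| ≤ δ) ∧ ∃ s M T, IsStep n δ (deriv k) (deriv k') s M T := by
  obtain ⟨K, hK0, hK⟩ := p.exists_lipschitzWith
  obtain ⟨W, hW0, hW⟩ := abs_le_of_continuous_of_periodic p.symm.continuous_deriv
    p.symm.deriv_periodic
  obtain ⟨v, hv0, hv⟩ := exists_pos_le_of_continuous_of_periodic p.symm.continuous_deriv
    p.symm.deriv_periodic p.symm.deriv_pos
  obtain ⟨δ', hδ', hosc⟩ := exists_abs_div_sub_one_le p.continuous_deriv p.deriv_periodic
    p.deriv_pos (θ := 1 / 2) (by norm_num)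
  set M : ℝ := 2 + (n + 1) * W / v with hM
  have hM2 : 2 ≤ M := by
    rw [hM]
    have : 0 ≤ (n + 1) * W / v := by positivity
    linarith
  obtain ⟨Q, G, s, c, pQ, hs, hQ1, hQ2, hQ3, hvol⟩ := exists_profile (M := M)
    (η := (1 / 2) ^ n / K) (by linarith) (by positivity)
  obtain ⟨C, hC0, hC⟩ := pQ.symm.exists_abs_sub_le
  obtain ⟨P, q, hqt, hq0, hpq⟩ := hL.exists_seq
  have hqt' : Tendsto (fun j => (q j : ℝ)) atTop atTop :=
    tendsto_natCast_atTop_atTop.comp hqt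
  have e1 := (rapidDecay_conj_cover p pQ.symm hqt hq0 hpq N).eventually_le hqt' hδ
  have e2 := (rapidDecay_conj_cover p pQ.symm (a := -α) (p := fun j => -P j) hqt hq0
    (fun j => by
      refine (le_of_eq ?_).trans (hpq j)
      rw [← abs_neg]
      push_cast
      congr 1
      ring) N).eventually_le hqt' hδ
  obtain ⟨j, e1, e2, e3, e4, e5⟩ := (e1.and (e2.and ((hqt'.eventually_ge_atTop (1 / δ')).and
    ((hqt'.eventually_ge_atTop (K * C / δ)).and (hqt'.eventually_ge_atTop (K / δ)))))).exists
  have hqj : (0 : ℝ) < q j := by exact_mod_cast hq0 j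
  refine ⟨_, _, p.comp (pQ.symm.cover (hq0 j)), ?_, fun x => ?_, s, M,
    {x | |Real.sin (2 * Real.pi * (q j * k x))| < c}, ?_⟩
  · rintro a (rfl | rfl)
    · exact e1
    · exact e2
  · have h1 := hK.dist_le_mul (G (q j * x) / q j) x
    rw [Real.dist_eq, Real.dist_eq] at h1
    refine h1.trans ?_
    have h2 : G (q j * x) / q j - x = (G (q j * x) - q j * x) / q j := by
      field_simp
    rw [h2, abs_div, abs_of_pos hqj]
    rw [div_le_iff₀ hδ] at e4
    rw [mul_div_assoc', div_le_iff₀ hqj]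
    calc K * |G (q j * x) - q j * x| ≤ K * C := by
          gcongr
          exact hC _
      _ ≤ δ * q j := by linarith
  · have hder : ∀ x, deriv (fun x => Q (q j * k x) / q j) x = deriv Q (q j * k x) * deriv k x :=
      fun x => by
      have h1 : HasDerivAt (fun x => (q j : ℝ) * k x) (q j * deriv k x) x :=
        (p.differentiable_inv x).hasDerivAt.const_mul _
      have h2 := ((pQ.differentiable (q j * k x)).hasDerivAt.comp x h1).div_const (q j : ℝ)
      refine HasDerivAt.deriv (h2.congr_deriv ?_)
      field_simp
    have hosc' : ∀ a b, |a - b| ≤ 1 / (q j : ℝ) → |deriv h a / deriv h b - 1| ≤ 1 / 2 := by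
      intro a b hab
      refine hosc a b (hab.trans ?_)
      rw [div_le_iff₀ hδ'] at e3
      rw [div_le_iff₀ hqj]
      linarith
    have hS : MeasurableSet {y : ℝ | |Real.sin (2 * Real.pi * y)| < c} :=
      measurableSet_lt (by fun_prop) measurable_const
    have hSp : ∀ x, x + 1 ∈ {y : ℝ | |Real.sin (2 * Real.pi * y)| < c} ↔
        x ∈ {y : ℝ | |Real.sin (2 * Real.pi * y)| < c} := fun x => by
      have := periodic_sin_two_pi x
      simp only at this
      simp only [Set.mem_ofPred_eq, this]
    have hkm : Measurable k := p.smooth_inv.continuous.measurable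
    refine ⟨hs, hM2, fun x y => ?_, ?_, fun x => ?_, ?_, fun x hx => ?_, fun x => ?_⟩
    · have h1 : (n + 1) * deriv k x ≤ (n + 1) * W := by
        gcongr
        exact (le_abs_self _).trans (hW x)
      have h2 : (n + 1) * W ≤ M * v := by
        rw [hM, add_mul 2, div_mul_cancel₀ _ hv0.ne']
        linarith
      have h3 : M * v ≤ M * deriv k y := by
        gcongr
        exact hv y
      linarith
    · exact hS.preimage (hkm.const_mul (q j : ℝ))
    · simp only [Set.mem_ofPred_eq]
      have := (periodic_sin_two_pi.nat_mul (q j)) (q j * k x)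
      simp only [mul_one] at this
      rw [p.add_one_inv, mul_add, mul_one, this]
    · refine (p.volume_preimage_le hK hS hSp (hq0 j)).trans ?_
      have hK' : (K : ENNReal) = ENNReal.ofReal K := by simp
      refine (mul_le_mul_right hvol _).trans ?_
      rw [hK', ← ENNReal.ofReal_mul (by positivity)]
      refine ENNReal.ofReal_le_ofReal (le_of_eq ?_)
      have : (K : ℝ) ≠ 0 := by exact_mod_cast hK0.ne'
      field_simp
    · simp only [hder]
      simp only [Set.mem_ofPred_eq, not_lt] at hx
      rcases hQ3 _ hx with h | h <;> rw [h]
      · exact .inl rfl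
      · exact .inr rfl
    · obtain ⟨a, ρ, m, hρ0, hρ1, hxm, hθ⟩ := p.exists_closedBall hK (hq0 j) hosc' x
      refine ⟨a, ρ, hρ0, hρ1.trans ?_, hxm, ?_, ?_⟩
      · rw [div_le_iff₀ hδ] at e5
        rw [div_le_iff₀ hqj]
        linarith
      · refine (hθ (1 / 12) (by norm_num) (by norm_num)).trans (measure_mono ?_)
        refine Set.inter_subset_inter_right _ fun y hy => ?_
        simp only [Set.mem_ofPred_eq, hder]
        rw [hQ1 _ (sin_two_pi_mul_ge m hy.1 (by linarith [hy.2]))]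
      · refine (hθ (7 / 12) (by norm_num) (by norm_num)).trans (measure_mono ?_)
        refine Set.inter_subset_inter_right _ fun y hy => ?_
        simp only [Set.mem_ofPred_eq, hder]
        rw [hQ2 _ (sin_two_pi_mul_le m hy.1 (by linarith [hy.2]))]

/-! ### Series with geometrically small terms -/

theorem le_mul_half_pow {δ : ℕ → ℝ} (hδ : ∀ n, δ (n + 1) ≤ δ n / 2) (n m : ℕ) :
    δ (m + n) ≤ δ n * (1 / 2) ^ m := by
  induction m with
  | zero => simp
  | succ m ih =>
    rw [show m + 1 + n = m + n + 1 by ring, pow_succ]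
    linarith [hδ (m + n)]

theorem hasSum_mul_half_pow (c : ℝ) : HasSum (fun m : ℕ => c * (1 / 2 : ℝ) ^ m) (2 * c) := by
  rw [mul_comm]
  exact hasSum_geometric_two.mul_left c

theorem summable_of_half {δ : ℕ → ℝ} (hδ0 : ∀ n, 0 < δ n) (hδ : ∀ n, δ (n + 1) ≤ δ n / 2) :
    Summable δ :=
  (hasSum_mul_half_pow (δ 0)).summable.of_nonneg_of_le (fun n => (hδ0 n).le)
    fun n => by simpa using le_mul_half_pow hδ 0 n

theorem abs_tsum_sub_sum_le {d δ : ℕ → ℝ} (hδ0 : ∀ n, 0 < δ n) (hδ : ∀ n, δ (n + 1) ≤ δ n / 2)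
    (hd : ∀ n, |d n| ≤ δ n) (n : ℕ) : |∑' m, d m - ∑ m ∈ Finset.range n, d m| ≤ 2 * δ n := by
  have hs : Summable d := (summable_of_half hδ0 hδ).of_norm_bounded hd
  rw [← hs.sum_add_tsum_nat_add n, add_sub_cancel_left, ← Real.norm_eq_abs]
  exact tsum_of_norm_bounded (hasSum_mul_half_pow (δ n)) fun m =>
    (hd _).trans (le_mul_half_pow hδ n m)

theorem exists_smooth_series {d : ℕ → ℝ → ℝ} (hd : ∀ n, ContDiff ℝ (⊤ : ℕ∞) (d n)) {δ : ℕ → ℝ}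
    (hδ0 : ∀ n, 0 < δ n) (hδ : ∀ n, δ (n + 1) ≤ δ n / 2) {r : ℕ}
    (hb : ∀ n, ∀ i ≤ n + r + 1, ∀ x, |iteratedDeriv i (d n) x| ≤ δ n) :
    ∃ S : ℝ → ℝ, ContDiff ℝ (⊤ : ℕ∞) S ∧ (∀ i ≤ r, ∀ x, |iteratedDeriv i S x| ≤ 2 * δ 0) ∧
      (∀ n x, |S x - ∑ m ∈ Finset.range n, d m x| ≤ 2 * δ n) ∧
      ∀ x, Tendsto (fun n => ∑ m ∈ Finset.range n, deriv (d m) x) atTop (𝓝 (deriv S x)) := by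
  have hsum := summable_of_half hδ0 hδ
  have hb' : ∀ n, ∀ i ≤ n + r + 1, ∀ x, ‖iteratedFDeriv ℝ i (d n) x‖ ≤ δ n := fun n i hi x => by
    rw [norm_iteratedFDeriv_eq_norm_iteratedDeriv]
    exact hb n i hi x
  have hb0 : ∀ n x, |d n x| ≤ δ n := fun n x => by
    simpa using hb n 0 (by omega) x
  have hb1 : ∀ n x, ‖deriv (d n) x‖ ≤ δ n := fun n x => by
    simpa using hb n 1 (by omega) x
  refine ⟨fun x => ∑' n, d n x, ?_, fun i hi x => ?_, fun n x => ?_, fun x => ?_⟩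
  · refine contDiff_tsum_of_eventually (v := fun _ n => δ n) hd (fun _ _ => hsum) fun i _ => ?_
    rw [Nat.cofinite_eq_atTop]
    filter_upwards [eventually_ge_atTop i] with n hn x
    exact hb' n i (by omega) x
  · have h1 := iteratedFDeriv_tsum_apply (𝕜 := ℝ) (f := d) (v := fun _ n => δ n) (N := (r : ℕ∞))
      (k := i) (fun n => (hd n).of_le (by exact_mod_cast le_top)) (fun _ _ => hsum)
      (fun i n x hi => hb' n i (by
        have : i ≤ r := by exact_mod_cast hi
        omega) x) (by exact_mod_cast hi) x
    rw [← Real.norm_eq_abs, ← norm_iteratedFDeriv_eq_norm_iteratedDeriv, h1]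
    refine tsum_of_norm_bounded (hasSum_mul_half_pow (δ 0)) fun n => ?_
    exact (hb' n i (by omega) x).trans (by simpa using le_mul_half_pow hδ 0 n)
  · exact abs_tsum_sub_sum_le hδ0 hδ (fun n => hb0 n x) n
  · have h1 := hasDerivAt_tsum (g := d) (g' := fun n => deriv (d n)) (y₀ := (0 : ℝ)) hsum
      (fun n y => (((hd n).differentiable (by simp)) y).hasDerivAt) (fun n y => hb1 n y)
      (hsum.of_norm_bounded fun n => hb0 n 0) x
    rw [h1.deriv]
    exact (hsum.of_norm_bounded fun n => hb1 n x).hasSum.tendsto_sum_nat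

/-! ### The sequence of conjugations -/

/-- The sequences `h n`, `k n = (h n)⁻¹` of conjugations used for a Liouville number `α`, with
their parameters. -/
structure IsConjSeq (α : ℝ) (r : ℕ) (h k : ℕ → ℝ → ℝ) (δ s M : ℕ → ℝ) (T : ℕ → Set ℝ) :
    Prop where
  pair : ∀ n, LiftPair (h n) (k n)
  h_zero : ∀ x, h 0 x = x
  k_zero : ∀ x, k 0 x = x
  pos : ∀ n, 0 < δ n
  zero_le : δ 0 ≤ (1 / 2) ^ (r + 2)
  half : ∀ n, δ (n + 1) ≤ δ n / 2
  osc : ∀ n a b, |a - b| ≤ 2 * δ n → |deriv (k n) a / deriv (k n) b - 1| ≤ (1 / 2) ^ n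
  close : ∀ n a, a = α ∨ a = -α → ∀ i ≤ n + r + 1, ∀ x,
    |iteratedDeriv i (fun x => h (n + 1) (k (n + 1) x + a) - h n (k n x + a)) x| ≤ δ n
  near : ∀ n x, |h (n + 1) x - h n x| ≤ δ n
  step : ∀ n, IsStep n (δ n) (deriv (k n)) (deriv (k (n + 1))) (s n) (M n) (T n)

theorem exists_isConjSeq {α : ℝ} (hL : Liouville α) (r : ℕ) :
    ∃ h k δ s M T, IsConjSeq α r h k δ s M T := by
  let X : ℕ → Type := fun n => {x : (ℝ → ℝ) × (ℝ → ℝ) × ℝ // LiftPair x.1 x.2.1 ∧ 0 < x.2.2 ∧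
    ∀ a b, |a - b| ≤ 2 * x.2.2 → |deriv x.2.1 a / deriv x.2.1 b - 1| ≤ (1 / 2) ^ n}
  let x₀ : X 0 := ⟨(fun x => x, fun x => x, (1 / 2) ^ (r + 2)), LiftPair.refl, by positivity,
    fun a b _ => by simp⟩
  have hstep : ∀ n (x : X n), ∃ y : X (n + 1), ∃ s M T, y.1.2.2 ≤ x.1.2.2 / 2 ∧
      (∀ a, a = α ∨ a = -α → ∀ i ≤ n + r + 1, ∀ z,
        |iteratedDeriv i (fun z => y.1.1 (y.1.2.1 z + a) - x.1.1 (x.1.2.1 z + a)) z| ≤ x.1.2.2) ∧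
      (∀ z, |y.1.1 z - x.1.1 z| ≤ x.1.2.2) ∧
      IsStep n x.1.2.2 (deriv x.1.2.1) (deriv y.1.2.1) s M T := by
    rintro n ⟨⟨h, k, δ⟩, p, hδ, -⟩
    obtain ⟨h', k', p', h1, h2, s, M, T, h3⟩ := exists_step p hL n (n + r + 1) hδ
    obtain ⟨δ', hδ', h4⟩ := exists_abs_div_sub_one_le p'.symm.continuous_deriv
      p'.symm.deriv_periodic p'.symm.deriv_pos (θ := (1 / 2) ^ (n + 1)) (by positivity)
    refine ⟨⟨(h', k', min (δ / 2) (δ' / 2)), p', lt_min (half_pos hδ) (half_pos hδ'), ?_⟩, s, M, T,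
      min_le_left _ _, h1, h2, h3⟩
    intro a b hab
    have := min_le_right (δ / 2) (δ' / 2)
    exact h4 a b (hab.trans (by linarith))
  choose next s M T h1 h2 h3 h4 using hstep
  let u : ∀ n, X n := fun n => Nat.rec x₀ (fun n x => next n x) n
  exact ⟨fun n => (u n).1.1, fun n => (u n).1.2.1, fun n => (u n).1.2.2, fun n => s n (u n),
    fun n => M n (u n), fun n => T n (u n), fun n => (u n).2.1, fun _ => rfl, fun _ => rfl,
    fun n => (u n).2.2.1, le_rfl, fun n => h1 n (u n), fun n => (u n).2.2.2,
    fun n => h2 n (u n), fun n => h3 n (u n), fun n => h4 n (u n)⟩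

namespace IsConjSeq

variable {α : ℝ} {r : ℕ} {h k : ℕ → ℝ → ℝ} {δ s M : ℕ → ℝ} {T : ℕ → Set ℝ}

theorem tendsto_zero (c : IsConjSeq α r h k δ s M T) : Tendsto δ atTop (𝓝 0) :=
  (summable_of_half c.pos c.half).tendsto_atTop_zero

theorem two_mul_zero_lt (c : IsConjSeq α r h k δ s M T) : 2 * δ 0 < ((2 : ℝ) ^ r)⁻¹ := by
  have h1 := c.zero_le
  rw [pow_add, one_div, inv_pow] at h1
  have : (0 : ℝ) < ((2 : ℝ) ^ r)⁻¹ := by positivity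
  linarith

/-- The conjugates of the rotation by `a = ± α` converge smoothly. -/
theorem exists_limit (c : IsConjSeq α r h k δ s M T) {a : ℝ} (ha : a = α ∨ a = -α) :
    ∃ f : ℝ → ℝ, ContDiff ℝ (⊤ : ℕ∞) f ∧ (∀ x, f (x + 1) = f x + 1) ∧
      CrNorm r (fun x => f x - (x + a)) ≤ 2 * δ 0 ∧
      (∀ n x, |f x - h n (k n x + a)| ≤ 2 * δ n) ∧
      ∀ x, Tendsto (fun n => deriv (fun x => h n (k n x + a)) x) atTop (𝓝 (deriv f x)) := by
  have hF : ∀ n, LiftPair (fun x => h n (k n x + a)) (fun x => h n (k n x - a)) :=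
    fun n => (c.pair n).conj_add_const a
  obtain ⟨S, hS, h1, h2, h3⟩ := exists_smooth_series
    (d := fun n x => h (n + 1) (k (n + 1) x + a) - h n (k n x + a))
    (fun n => (hF (n + 1)).smooth.sub (hF n).smooth) c.pos c.half fun n => c.close n a ha
  have h0 : ∀ x, h 0 (k 0 x + a) = x + a := fun x => by rw [c.h_zero, c.k_zero]
  have hsum : ∀ n x, ∑ m ∈ Finset.range n, (h (m + 1) (k (m + 1) x + a) - h m (k m x + a)) =
      h n (k n x + a) - (x + a) := fun n x => by
    rw [Finset.sum_range_sub fun m => h m (k m x + a), h0]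
  simp only [hsum] at h2
  have h2' : ∀ n x, |S x + (x + a) - h n (k n x + a)| ≤ 2 * δ n := fun n x => by
    rw [show S x + (x + a) - h n (k n x + a) = S x - (h n (k n x + a) - (x + a)) by ring]
    exact h2 n x
  have hlim : ∀ x, Tendsto (fun n => h n (k n x + a)) atTop (𝓝 (S x + (x + a))) := fun x => by
    rw [tendsto_iff_dist_tendsto_zero]
    refine squeeze_zero (fun _ => dist_nonneg) (fun n => ?_)
      (by simpa using c.tendsto_zero.const_mul 2)
    rw [dist_comm, Real.dist_eq]
    exact h2' n x
  refine ⟨fun x => S x + (x + a), hS.add (contDiff_id.add contDiff_const), fun x => ?_, ?_, h2',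
    fun x => ?_⟩
  · refine tendsto_nhds_unique (hlim (x + 1)) ?_
    refine ((hlim x).add_const 1).congr fun n => ?_
    exact ((hF n).add_one x).symm
  · refine Finset.sup'_le _ _ fun i hi => ?_
    simp only [add_sub_cancel_right]
    exact ciSup_le fun x => h1 i (Finset.mem_range_succ_iff.1 hi) x
  · have e1 : deriv (fun x => S x + (x + a)) x = deriv S x + 1 :=
      HasDerivAt.deriv ((hS.differentiable (by simp) x).hasDerivAt.add
        ((hasDerivAt_id x).add_const a))
    rw [e1]
    refine ((h3 x).add_const 1).congr fun n => ?_
    have e2 : ∀ m, deriv (fun x => h (m + 1) (k (m + 1) x + a) - h m (k m x + a)) x =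
        deriv (fun x => h (m + 1) (k (m + 1) x + a)) x - deriv (fun x => h m (k m x + a)) x :=
      fun m => deriv_fun_sub ((hF (m + 1)).differentiable x) ((hF m).differentiable x)
    simp only [e2]
    rw [Finset.sum_range_sub fun m => deriv (fun x => h m (k m x + a)) x]
    have e3 : deriv (fun x => h 0 (k 0 x + a)) x = 1 := by
      simp [h0]
    rw [e3, sub_add_cancel]

theorem tendstoUniformly (c : IsConjSeq α r h k δ s M T) {F : ℕ → ℝ → ℝ} {f : ℝ → ℝ}
    (hf : ∀ n x, |f x - F n x| ≤ 2 * δ n) : TendstoUniformly F f atTop := by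
  rw [Metric.tendstoUniformly_iff]
  intro ε hε
  have := c.tendsto_zero.const_mul 2
  rw [mul_zero] at this
  filter_upwards [this.eventually (gt_mem_nhds hε)] with n hn x
  rw [Real.dist_eq]
  exact (hf n x).trans_lt hn

/-- The limit of the conjugations. -/
theorem exists_semiconj (c : IsConjSeq α r h k δ s M T) :
    ∃ H : ℝ → ℝ, Continuous H ∧ Monotone H ∧ (∀ y, H (y + 1) = H y + 1) ∧
      ∀ n y, |H y - h n y| ≤ 2 * δ n := by
  have hle : ∀ y n, |h (n + 1) y - h n y| ≤ δ n := fun y n => c.near n y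
  have h1 : ∀ n y, |∑' m, (h (m + 1) y - h m y) - (h n y - h 0 y)| ≤ 2 * δ n := fun n y => by
    have := abs_tsum_sub_sum_le c.pos c.half (hle y) n
    rwa [Finset.sum_range_sub fun m => h m y] at this
  let H : ℝ → ℝ := fun y => ∑' m, (h (m + 1) y - h m y) + h 0 y
  have h2 : ∀ n y, |H y - h n y| ≤ 2 * δ n := fun n y => by
    have := h1 n y
    rwa [show ∑' m, (h (m + 1) y - h m y) - (h n y - h 0 y) = H y - h n y by
      simp only [H]; ring] at this
  have hu := c.tendstoUniformly h2
  refine ⟨H, hu.continuous (Frequently.of_forall fun n => (c.pair n).smooth.continuous),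
    fun a b hab => ?_, fun y => ?_, h2⟩
  · exact le_of_tendsto_of_tendsto' (hu.tendsto_at a) (hu.tendsto_at b)
      fun n => (c.pair n).strictMono.monotone hab
  · refine tendsto_nhds_unique (hu.tendsto_at (y + 1)) ?_
    exact ((hu.tendsto_at y).add_const 1).congr fun n => ((c.pair n).add_one y).symm

/-- The limit diffeomorphism. -/
theorem exists_diffeo (c : IsConjSeq α r h k δ s M T) :
    ∃ f fi : ℝ → ℝ, LiftPair f fi ∧ CrNorm r (fun x => f x - (x + α)) < ((2 : ℝ) ^ r)⁻¹ ∧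
      CrNorm r (fun x => fi x - (x - α)) < ((2 : ℝ) ^ r)⁻¹ ∧
      (∀ n x, |f x - h n (k n x + α)| ≤ 2 * δ n) ∧
      ∀ x, Tendsto (fun n => deriv (k n) x / deriv (k n) (f x)) atTop (𝓝 (deriv f x)) := by
  obtain ⟨f, hf, f1, f2, f3, f4⟩ := c.exists_limit (.inl rfl)
  obtain ⟨g, hg, g1, g2, g3, g4⟩ := c.exists_limit (.inr rfl)
  have uf := c.tendstoUniformly f3
  have ug := c.tendstoUniformly g3
  have hfg : ∀ x, f (g x) = x := fun x =>
    tendsto_nhds_unique (uf.tendsto_comp hf.continuous.continuousAt (ug.tendsto_at x))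
      (tendsto_const_nhds.congr fun n => by simp [(c.pair n).inv_apply, (c.pair n).apply_inv])
  have hgf : ∀ x, g (f x) = x := fun x =>
    tendsto_nhds_unique (ug.tendsto_comp hg.continuous.continuousAt (uf.tendsto_at x))
      (tendsto_const_nhds.congr fun n => by simp [(c.pair n).inv_apply, (c.pair n).apply_inv])
  have hpos : ∀ x, 0 < deriv f x := fun x => by
    have h0 : 0 ≤ deriv f x := ge_of_tendsto' (f4 x) fun n =>
      (((c.pair n).conj_add_const α).deriv_pos x).le
    refine h0.lt_of_ne' fun h => ?_
    have h1 := (hg.differentiable (by simp) (f x)).hasDerivAt.comp x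
      (hf.differentiable (by simp) x).hasDerivAt
    rw [show g ∘ f = id from funext hgf, h, mul_zero] at h1
    exact zero_ne_one (h1.unique (hasDerivAt_id x))
  refine ⟨f, g, ⟨hf, hg, f1, g1, hfg, hgf, hpos⟩, f2.trans_lt c.two_mul_zero_lt, ?_, f3,
    fun x => ?_⟩
  · simp only [← sub_eq_add_neg] at g2
    exact g2.trans_lt c.two_mul_zero_lt
  · have h1 : ∀ n, deriv (fun x => h n (k n x + α)) x =
        deriv (k n) x / deriv (k n) (h n (k n x + α)) := fun n => by
      have e1 := ((c.pair n).differentiable (k n x + α)).hasDerivAt.comp x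
        (((c.pair n).differentiable_inv x).hasDerivAt.add_const α)
      have e2 := (c.pair n).deriv_mul_deriv_inv (h n (k n x + α))
      rw [(c.pair n).inv_apply] at e2
      have e3 := ((c.pair n).symm.deriv_pos (h n (k n x + α))).ne'
      rw [show deriv (fun x => h n (k n x + α)) x = _ from e1.deriv, eq_div_iff e3]
      linear_combination deriv (k n) x * e2
    have h2 : Tendsto (fun n => deriv (k n) (h n (k n x + α)) / deriv (k n) (f x)) atTop
        (𝓝 1) := by
      rw [tendsto_iff_dist_tendsto_zero]
      refine squeeze_zero (fun _ => dist_nonneg) (fun n => ?_)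
        (tendsto_pow_atTop_nhds_zero_of_lt_one (r := (1 / 2 : ℝ)) (by norm_num) (by norm_num))
      rw [Real.dist_eq]
      refine c.osc n _ _ ?_
      rw [abs_sub_comm]
      exact f3 n x
    have h3 := (f4 x).mul h2
    rw [mul_one] at h3
    refine h3.congr fun n => ?_
    rw [h1]
    exact div_mul_div_cancel₀ ((c.pair n).symm.deriv_pos _).ne'

theorem apply_semiconj (c : IsConjSeq α r h k δ s M T) {f H : ℝ → ℝ} (hfc : Continuous f)
    (hf : ∀ n x, |f x - h n (k n x + α)| ≤ 2 * δ n) (hH : ∀ n y, |H y - h n y| ≤ 2 * δ n) (y : ℝ) :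
    f (H y) = H (y + α) := by
  refine tendsto_nhds_unique ((c.tendstoUniformly hf).tendsto_comp hfc.continuousAt
    ((c.tendstoUniformly hH).tendsto_at y)) ?_
  refine ((c.tendstoUniformly hH).tendsto_at (y + α)).congr fun n => ?_
  rw [(c.pair n).inv_apply]

end IsConjSeq

/-! ### Rational approximation and residues -/

theorem exists_rat_abs_sub_le_one_div_den_sq {α : ℝ} (hα : Irrational α) (N : ℕ) :
    ∃ r : ℚ, N < r.den ∧ |α - r| ≤ 1 / (r.den : ℝ) ^ 2 := by
  obtain ⟨ε, hε0, hε⟩ := ((self_mem_nhdsWithin : Set.Ioi (0 : ℝ) ∈ 𝓝[>] (0 : ℝ)) |>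
    fun h0 => (show ∀ᶠ ε in 𝓝[>] (0 : ℝ), 0 < ε from h0).and
      ((hα.eventually_forall_le_dist_cast_rat_of_den_le N).filter_mono nhdsWithin_le_nhds)).exists
  obtain ⟨n, hn⟩ := exists_nat_one_div_lt hε0
  obtain ⟨r, h1, h2⟩ := Real.exists_rat_abs_sub_le_and_den_le α n.succ_pos
  have hd : (0 : ℝ) < r.den := by exact_mod_cast r.den_pos
  have hd1 : (1 : ℝ) ≤ r.den := by exact_mod_cast r.den_pos
  have h2' : (r.den : ℝ) ≤ n + 1 := by exact_mod_cast h2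
  push_cast at h1
  refine ⟨r, ?_, h1.trans ?_⟩
  · by_contra hN
    have h3 := hε r (not_lt.1 hN)
    rw [Real.dist_eq] at h3
    have h4 : 1 / (((n : ℝ) + 1 + 1) * r.den) ≤ 1 / ((n : ℝ) + 1) := by
      refine one_div_le_one_div_of_le (by positivity) ?_
      nlinarith
    linarith
  · refine one_div_le_one_div_of_le (by positivity) ?_
    nlinarith

theorem exists_mul_emod_eq {p : ℤ} {q : ℕ} (hpq : IsCoprime p q) {c : ℕ} (hc : c < q) :
    ∃ l < q, (l * p) % (q : ℤ) = c := by
  obtain ⟨u, v, huv⟩ := hpq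
  have hq : (0 : ℤ) < q := by omega
  have h0 := Int.emod_nonneg (c * u) hq.ne'
  have h1 := Int.emod_lt_of_pos (c * u) hq
  refine ⟨((c * u) % q).toNat, by omega, ?_⟩
  rw [Int.toNat_of_nonneg h0]
  have h2 : (c * u % q) * p ≡ (c : ℤ) [ZMOD q] := by
    have h3 : (c * u % q) * p ≡ (c * u) * p [ZMOD q] := (Int.mod_modEq _ _).mul_right _
    refine h3.trans ?_
    rw [show (c : ℤ) * u * p = c + q * (-(c * v)) by linear_combination (c : ℤ) * huv]
    exact (Int.modEq_add_fac_self (n := (q : ℤ)))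
  rw [h2, Int.emod_eq_of_lt (by positivity) (by exact_mod_cast hc)]

theorem sum_mul_emod {p : ℤ} {q : ℕ} (hpq : IsCoprime p q) (φ : ℕ → ℝ) :
    ∑ l ∈ Finset.range q, φ ((l * p) % (q : ℤ)).toNat = ∑ c ∈ Finset.range q, φ c := by
  have himg : (Finset.range q).image (fun l : ℕ => ((l * p) % (q : ℤ)).toNat) =
      Finset.range q := by
    ext c
    simp only [Finset.mem_image, Finset.mem_range]
    constructor
    · rintro ⟨l, hl, rfl⟩
      have hq : (0 : ℤ) < q := by omega
      have h1 := Int.emod_lt_of_pos (l * p) hq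
      omega
    · intro hc
      obtain ⟨l, hl, h⟩ := exists_mul_emod_eq hpq hc
      exact ⟨l, hl, by rw [h]; simp⟩
  have hinj := Finset.injOn_of_card_image_eq (congrArg Finset.card himg)
  rw [← Finset.sum_image (f := φ) hinj, himg]

theorem sum_range_add_sub (u : ℕ → ℝ) (q m : ℕ) (hu : ∀ c, u (c + q) = u c + 1) :
    ∑ c ∈ Finset.range q, (u (c + m) - u c) = m := by
  induction m with
  | zero => simp
  | succ m ih =>
    have h1 : ∀ c, u (c + (m + 1)) - u c = (u (c + 1 + m) - u (c + m)) + (u (c + m) - u c) :=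
      fun c => by rw [show c + (m + 1) = c + 1 + m by ring]; ring
    simp only [h1]
    rw [Finset.sum_add_distrib, ih, Finset.sum_range_sub fun c => u (c + m), zero_add,
      add_comm q m, hu]
    push_cast
    ring

/-! ### Density points and null sets -/

theorem ae_volume_closedBall_diff_le {E : Set ℝ} (hE : MeasurableSet E) :
    ∀ᵐ x, x ∈ E → ∀ η : ℝ, 0 < η → ∃ r : ℝ, 0 < r ∧ ∀ c ρ : ℝ, 0 < ρ → ρ ≤ r →
      x ∈ Metric.closedBall c ρ → volume (Metric.closedBall c ρ \ E) ≤ ENNReal.ofReal (η * ρ) := by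
  have h := IsUnifLocDoublingMeasure.ae_tendsto_measure_inter_div (volume : Measure ℝ) E 1
  rw [ae_restrict_iff' hE] at h
  filter_upwards [h] with x hx hxE η hη
  by_contra! hcon
  choose! c ρ h1 h2 h3 h4 using fun n : ℕ => hcon (1 / ((n : ℝ) + 1)) (by positivity)
  have hlim : Tendsto ρ atTop (𝓝[>] 0) :=
    tendsto_nhdsWithin_iff.2 ⟨squeeze_zero (fun n => (h1 n).le) h2
      tendsto_one_div_add_atTop_nhds_zero_nat, Eventually.of_forall h1⟩
  have ht := hx hxE c ρ hlim (Eventually.of_forall fun n => by rw [one_mul]; exact h3 n)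
  have hvol : ∀ n, volume (Metric.closedBall (c n) (ρ n)) = ENNReal.ofReal (2 * ρ n) := fun n =>
    Real.volume_closedBall _ _
  have hbound : ∀ n, volume (E ∩ Metric.closedBall (c n) (ρ n)) /
      volume (Metric.closedBall (c n) (ρ n)) ≤ ENNReal.ofReal (1 - η / 2) := by
    intro n
    have hs := measure_inter_add_sdiff (μ := volume) (Metric.closedBall (c n) (ρ n)) hE
    rw [Set.inter_comm, hvol] at hs
    rw [hvol]
    have hρ := h1 n
    have e1 : volume (E ∩ Metric.closedBall (c n) (ρ n)) ≤
        ENNReal.ofReal (2 * ρ n - η * ρ n) := by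
      rw [ENNReal.ofReal_sub _ (by positivity), ← hs]
      refine ENNReal.le_sub_of_add_le_right ENNReal.ofReal_ne_top ?_
      gcongr
      exact (h4 n).le
    refine ENNReal.div_le_of_le_mul (e1.trans ?_)
    rcases le_or_gt 0 (1 - η / 2) with hp | hp
    · rw [← ENNReal.ofReal_mul hp]
      exact ENNReal.ofReal_le_ofReal (by nlinarith)
    · rw [ENNReal.ofReal_of_nonpos (by nlinarith : 2 * ρ n - η * ρ n ≤ 0)]
      exact zero_le
  have h5 := le_of_tendsto' ht hbound
  rw [ENNReal.one_le_ofReal] at h5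
  linarith

theorem exists_mem_of_ae {E : Set ℝ} (hE : volume E ≠ 0) {P : ℝ → Prop} (hP : ∀ᵐ x, x ∈ E → P x) :
    ∃ x ∈ E, P x := by
  by_contra! h
  refine hE (measure_mono_null (fun x hx => ?_) (ae_iff.1 hP))
  exact fun h' => h x hx (h' hx)

theorem volume_eq_zero_of_periodic {S : Set ℝ} (hp : ∀ x, x + 1 ∈ S ↔ x ∈ S) (a : ℝ)
    (h : volume (S ∩ Set.Ico a (a + 1)) = 0) : volume S = 0 := by
  have hz : ∀ (m : ℤ) (x : ℝ), x + m ∈ S ↔ x ∈ S := fun m x => by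
    have : Function.Periodic (fun x => x ∈ S) 1 := fun x => propext (hp x)
    simpa using this.int_mul m x
  refine measure_mono_null (t := ⋃ m : ℤ, (fun x => x + (m : ℝ)) ⁻¹' (S ∩ Set.Ico a (a + 1)))
    (fun x hx => ?_) (measure_iUnion_null fun m => ?_)
  · refine Set.mem_iUnion.2 ⟨-⌊x - a⌋, (hz _ _).2 hx, ?_, ?_⟩
    · have := Int.floor_le (x - a)
      push_cast
      linarith
    · have := Int.lt_floor_add_one (x - a)
      push_cast
      linarith
  · rw [measure_preimage_add_right, h]

/-! ### Iterates and distortion -/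

namespace LiftPair

variable {f g : ℝ → ℝ}

theorem iterate (p : LiftPair f g) (n : ℕ) : LiftPair (f^[n]) (g^[n]) := by
  induction n with
  | zero => exact LiftPair.refl
  | succ n ih =>
    rw [Function.iterate_succ', Function.iterate_succ]
    exact p.comp ih

theorem deriv_iterate_succ (p : LiftPair f g) (n : ℕ) (x : ℝ) :
    deriv (f^[n + 1]) x = deriv f (f^[n] x) * deriv (f^[n]) x := by
  rw [Function.iterate_succ']
  exact ((p.differentiable _).hasDerivAt.comp x ((p.iterate n).differentiable x).hasDerivAt).deriv

theorem exists_distortion (p : LiftPair f g) : ∃ L : ℝ, 0 < L ∧ ∀ (n : ℕ) (a b : ℝ),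
    deriv (f^[n]) a ≤
      Real.exp (L * ∑ l ∈ Finset.range n, |f^[l] a - f^[l] b|) * deriv (f^[n]) b := by
  obtain ⟨c, hc, hcle⟩ := exists_pos_le_of_continuous_of_periodic p.continuous_deriv
    p.deriv_periodic p.deriv_pos
  obtain ⟨C, hC, hCle⟩ := abs_le_of_continuous_of_periodic
    (contDiff_infty_iff_deriv.1 p.contDiff_deriv).2.continuous
    (fun x => by rw [← deriv_comp_add_const, funext p.deriv_periodic])
  have hLip : ∀ a b, |deriv f a - deriv f b| ≤ C * |a - b| := fun a b => by
    have := (convex_univ (𝕜 := ℝ) (E := ℝ)).norm_image_sub_le_of_norm_deriv_le (f := deriv f)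
      (fun x _ => (contDiff_infty_iff_deriv.1 p.contDiff_deriv).1 x)
      (fun x _ => hCle x) (Set.mem_univ b) (Set.mem_univ a)
    simpa using this
  refine ⟨C / c, by positivity, fun n a b => ?_⟩
  induction n with
  | zero => simp
  | succ n ih =>
    rw [p.deriv_iterate_succ, p.deriv_iterate_succ, Finset.sum_range_succ, mul_add, Real.exp_add]
    set u := f^[n] a
    set v := f^[n] b
    have h1 : deriv f u ≤ Real.exp (C / c * |u - v|) * deriv f v := by
      have e1 := Real.add_one_le_exp (C / c * |u - v|)
      have e2 := p.deriv_pos v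
      have e3 := (abs_le.1 (hLip u v)).2
      have e4 : C * |u - v| ≤ C / c * |u - v| * deriv f v := by
        rw [div_mul_eq_mul_div, div_mul_eq_mul_div, le_div_iff₀ hc]
        exact mul_le_mul_of_nonneg_left (hcle v) (by positivity)
      nlinarith
    calc deriv f u * deriv (f^[n]) a
        ≤ (Real.exp (C / c * |u - v|) * deriv f v) *
          (Real.exp (C / c * ∑ l ∈ Finset.range n, |f^[l] a - f^[l] b|) * deriv (f^[n]) b) :=
          mul_le_mul h1 ih ((p.iterate n).deriv_pos a).le
            (mul_nonneg (Real.exp_nonneg _) (p.deriv_pos v).le)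
      _ = _ := by ring

end LiftPair

/-! ### Ergodicity -/

theorem iterate_semiconj {f H : ℝ → ℝ} {α : ℝ} (Hf : ∀ y, f (H y) = H (y + α)) (n : ℕ) (y : ℝ) :
    f^[n] (H y) = H (y + n * α) := by
  induction n with
  | zero => simp
  | succ n ih =>
    rw [Function.iterate_succ_apply', ih, Hf]
    push_cast
    ring_nf

theorem surjective_of_add_one {H : ℝ → ℝ} (Hc : Continuous H) (H1 : ∀ y, H (y + 1) = H y + 1) :
    Function.Surjective H := by
  obtain ⟨C, -, hC⟩ := abs_le_of_continuous_of_periodic (φ := fun x => H x - x)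
    (Hc.sub continuous_id) fun x => by simp only [H1]; ring
  refine Hc.surjective ?_ ?_
  · exact tendsto_atTop_mono (f := fun x => x + -C) (fun x => by linarith [(abs_le.1 (hC x)).1])
      (tendsto_atTop_add_const_right _ _ tendsto_id)
  · exact tendsto_atBot_mono (fun x => show H x ≤ x + C by linarith [(abs_le.1 (hC x)).2])
      (tendsto_atBot_add_const_right _ _ tendsto_id)

theorem nat_mul_sub_le {α : ℝ} {r : ℚ} (hr : |α - r| ≤ 1 / (r.den : ℝ) ^ 2) {l : ℕ}
    (hl : l < r.den) :
    |l * α - (((l * r.num / (r.den : ℤ) : ℤ) : ℝ) +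
      (((l * r.num) % (r.den : ℤ)).toNat : ℝ) / r.den)| ≤ 1 / r.den := by
  have hd : (0 : ℝ) < r.den := by exact_mod_cast r.den_pos
  have h0 := Int.emod_nonneg (l * r.num) (b := (r.den : ℤ)) (by exact_mod_cast r.den_nz)
  have h1 : (((l * r.num) % (r.den : ℤ)).toNat : ℝ) = (((l * r.num) % (r.den : ℤ) : ℤ) : ℝ) := by
    exact_mod_cast Int.toNat_of_nonneg h0
  have h2 : (((r.den : ℤ) * (l * r.num / (r.den : ℤ)) + (l * r.num) % (r.den : ℤ) : ℤ) : ℝ) =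
      l * r.num := by
    rw [Int.mul_ediv_add_emod]
    push_cast
    rfl
  push_cast at h2
  have h3 : ((l * r.num / (r.den : ℤ) : ℤ) : ℝ) + (((l * r.num) % (r.den : ℤ) : ℤ) : ℝ) / r.den =
      l * r := by
    rw [← mul_left_cancel_iff_of_pos hd, mul_add, mul_div_cancel₀ _ hd.ne', h2]
    conv_rhs => rw [Rat.cast_def]
    field_simp
  have hl' : (l : ℝ) ≤ r.den := by exact_mod_cast hl.le
  rw [h1, h3, ← mul_sub, abs_mul, Nat.abs_cast]
  calc (l : ℝ) * |α - r| ≤ r.den * (1 / (r.den : ℝ) ^ 2) := by gcongr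
    _ = 1 / r.den := by field_simp

section Semiconj

variable {f g H : ℝ → ℝ} {α : ℝ}

theorem sum_length_le (Hm : Monotone H) (H1 : ∀ y, H (y + 1) = H y + 1) {r : ℚ}
    (hr : |α - r| ≤ 1 / (r.den : ℝ) ^ 2) (y : ℝ) :
    ∑ l ∈ Finset.range r.den, (H (y + 2 / r.den + l * α) - H (y - 1 / r.den + l * α)) ≤ 5 := by
  have hd : (0 : ℝ) < r.den := by exact_mod_cast r.den_pos
  let u : ℕ → ℝ := fun c => H (y + (c - 2) / r.den)
  have hu : ∀ c, u (c + r.den) = u c + 1 := fun c => by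
    simp only [u]
    rw [← H1]
    congr 1
    push_cast
    field_simp
    ring
  calc _ ≤ ∑ l ∈ Finset.range r.den, (u (((l * r.num) % (r.den : ℤ)).toNat + 5) -
        u ((l * r.num) % (r.den : ℤ)).toNat) := by
        refine Finset.sum_le_sum fun l hl => ?_
        have h1 := abs_le.1 (nat_mul_sub_le hr (Finset.mem_range.1 hl))
        set m := (l * r.num / (r.den : ℤ) : ℤ)
        set c := ((l * r.num) % (r.den : ℤ)).toNat
        have e1 : H (y + 2 / r.den + l * α) ≤ u (c + 5) + m := by
          simp only [u]
          rw [← add_intCast_of_add_one H1]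
          refine Hm ?_
          push_cast
          have : ((c : ℝ) + 5 - 2) / r.den = c / r.den + 2 / r.den + 1 / r.den := by ring
          linarith
        have e2 : u c + m ≤ H (y - 1 / r.den + l * α) := by
          simp only [u]
          rw [← add_intCast_of_add_one H1]
          refine Hm ?_
          have : ((c : ℝ) - 2) / r.den = c / r.den - 1 / r.den - 1 / r.den := by ring
          linarith
        linarith
    _ = 5 := by
        rw [sum_mul_emod r.isCoprime_num_den (fun c => u (c + 5) - u c),
          sum_range_add_sub u r.den 5 hu]
        norm_num

theorem Ico_subset_iUnion_image (Hc : Continuous H) (Hm : Monotone H)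
    (H1 : ∀ y, H (y + 1) = H y + 1) (Hf : ∀ y, f (H y) = H (y + α)) {r : ℚ}
    (hr : |α - r| ≤ 1 / (r.den : ℝ) ^ 2) (y : ℝ) :
    Set.Ico (H y) (H y + 1) ⊆ ⋃ l ∈ Finset.range r.den,
      (fun z => f^[l] z - (l * r.num / (r.den : ℤ) : ℤ)) ''
        Set.Icc (H (y - 1 / r.den)) (H (y + 2 / r.den)) := by
  intro z hz
  have hd : (0 : ℝ) < r.den := by exact_mod_cast r.den_pos
  obtain ⟨t, ⟨ht0, ht1⟩, rfl⟩ := intermediate_value_Icc (by linarith : y ≤ y + 1)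
    Hc.continuousOn ⟨hz.1, by rw [H1]; exact hz.2.le⟩
  have ht1 : t < y + 1 := by
    refine lt_of_le_of_ne ht1 fun h => ?_
    have := hz.2
    rw [h, H1] at this
    exact lt_irrefl _ this
  have hnn : 0 ≤ r.den * (t - y) := mul_nonneg hd.le (by linarith)
  set c := ⌊r.den * (t - y)⌋₊ with hc
  have c1 : (c : ℝ) ≤ r.den * (t - y) := Nat.floor_le hnn
  have c2 : r.den * (t - y) < c + 1 := Nat.lt_floor_add_one _
  have c3 : c < r.den := by
    rw [hc, Nat.floor_lt hnn]
    nlinarith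
  obtain ⟨l, hl, hlc⟩ := exists_mul_emod_eq r.isCoprime_num_den c3
  have h1 := abs_le.1 (nat_mul_sub_le hr hl)
  rw [hlc, Int.toNat_natCast] at h1
  refine Set.mem_iUnion₂.2 ⟨l, Finset.mem_range.2 hl, ?_⟩
  set m := (l * r.num / (r.den : ℤ) : ℤ)
  have c1' : (c : ℝ) / r.den ≤ t - y := by rw [div_le_iff₀ hd]; linarith
  have c2' : t - y ≤ c / r.den + 1 / r.den := by rw [← add_div, le_div_iff₀ hd]; linarith
  refine ⟨H (t + m - l * α), ⟨Hm ?_, Hm ?_⟩, ?_⟩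
  · linarith
  · have : (2 : ℝ) / r.den = 1 / r.den + 1 / r.den := by ring
    linarith
  · simp only
    rw [iterate_semiconj Hf, sub_add_cancel, add_intCast_of_add_one H1, add_sub_cancel_right]

theorem LiftPair.volume_image_iterate_le (p : LiftPair f g) {L : ℝ}
    (hL : ∀ (n : ℕ) (a b : ℝ), deriv (f^[n]) a ≤
      Real.exp (L * ∑ l ∈ Finset.range n, |f^[l] a - f^[l] b|) * deriv (f^[n]) b) (hL0 : 0 < L)
    {b₁ b₂ : ℝ} (hb : b₁ ≤ b₂) {n : ℕ}
    (hsum : ∑ l ∈ Finset.range n, (f^[l] b₂ - f^[l] b₁) ≤ 5) {E : Set ℝ} {η : ℝ}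
    (hE : volume (Set.Icc b₁ b₂ \ E) ≤ ENNReal.ofReal (η * (b₂ - b₁))) (hη : 0 < η) {l : ℕ}
    (hl : l < n) :
    volume (f^[l] '' (Set.Icc b₁ b₂ \ E)) ≤
      ENNReal.ofReal (Real.exp (L * 5) ^ 2 * η * (f^[l] b₂ - f^[l] b₁)) := by
  set K := Real.exp (L * 5) with hK
  have hK0 : 0 < K := Real.exp_pos _
  have hdist : ∀ a ∈ Set.Icc b₁ b₂, ∀ b ∈ Set.Icc b₁ b₂, deriv (f^[l]) a ≤ K * deriv (f^[l]) b := by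
    intro a ha b hb'
    refine (hL l a b).trans (mul_le_mul_of_nonneg_right ?_ ((p.iterate l).deriv_pos b).le)
    refine Real.exp_le_exp.2 (mul_le_mul_of_nonneg_left (le_trans ?_ hsum) hL0.le)
    calc ∑ i ∈ Finset.range l, |f^[i] a - f^[i] b|
        ≤ ∑ i ∈ Finset.range l, (f^[i] b₂ - f^[i] b₁) := by
          refine Finset.sum_le_sum fun i _ => ?_
          have hm := (p.iterate i).strictMono.monotone
          rw [abs_le]
          constructor <;> linarith [hm ha.1, hm ha.2, hm hb'.1, hm hb'.2]
      _ ≤ ∑ i ∈ Finset.range n, (f^[i] b₂ - f^[i] b₁) := by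
          refine Finset.sum_le_sum_of_subset_of_nonneg (Finset.range_mono hl.le) fun i _ _ => ?_
          linarith [(p.iterate i).strictMono.monotone hb]
  set d := deriv (f^[l]) b₁ with hd
  have hd0 : 0 < d := (p.iterate l).deriv_pos _
  have hb1 : b₁ ∈ Set.Icc b₁ b₂ := ⟨le_rfl, hb⟩
  have hLip : LipschitzOnWith (K * d).toNNReal (f^[l]) (Set.Icc b₁ b₂) := by
    refine (convex_Icc b₁ b₂).lipschitzOnWith_of_nnnorm_deriv_le
      (fun x _ => (p.iterate l).differentiable x) fun x hx => ?_
    rw [← NNReal.coe_le_coe, coe_nnnorm, Real.coe_toNNReal _ (by positivity), Real.norm_eq_abs,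
      abs_of_pos ((p.iterate l).deriv_pos x)]
    exact hdist x hx b₁ hb1
  have hlow : d / K * (b₂ - b₁) ≤ f^[l] b₂ - f^[l] b₁ := by
    refine (convex_Icc b₁ b₂).mul_sub_le_image_sub_of_le_deriv
      (p.iterate l).smooth.continuous.continuousOn (p.iterate l).differentiable.differentiableOn
      (fun x hx => ?_) b₁ hb1 b₂ ⟨hb, le_rfl⟩ hb
    rw [div_le_iff₀ hK0]
    have := hdist b₁ hb1 x (interior_subset hx)
    linarith
  have h1 := (hLip.mono (Set.sdiff_subset (t := E))).hausdorffMeasure_image_le zero_le_one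
  rw [MeasureTheory.hausdorffMeasure_real, ENNReal.rpow_one] at h1
  refine h1.trans ((mul_le_mul_right hE _).trans ?_)
  rw [← ENNReal.ofReal, ← ENNReal.ofReal_mul (by positivity)]
  refine ENNReal.ofReal_le_ofReal ?_
  rw [div_mul_eq_mul_div, div_le_iff₀ hK0] at hlow
  nlinarith [mul_le_mul_of_nonneg_left hlow (by positivity : 0 ≤ K * η)]

theorem LiftPair.volume_compl_eq_zero (p : LiftPair f g) (hα : Irrational α) (Hc : Continuous H)
    (Hm : Monotone H) (H1 : ∀ y, H (y + 1) = H y + 1) (Hf : ∀ y, f (H y) = H (y + α))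
    {E : Set ℝ} (hE : MeasurableSet E) (hE1 : ∀ x, x + 1 ∈ E ↔ x ∈ E)
    (hEf : ∀ x, f x ∈ E ↔ x ∈ E) (hE0 : volume E ≠ 0) : volume Eᶜ = 0 := by
  obtain ⟨x, -, hx⟩ := exists_mem_of_ae hE0 (ae_volume_closedBall_diff_le hE)
  obtain ⟨y, rfl⟩ := surjective_of_add_one Hc H1 x
  obtain ⟨L, hL0, hL⟩ := p.exists_distortion
  refine volume_eq_zero_of_periodic (fun x => not_congr (hE1 x)) (H y) ?_
  refine le_antisymm (ENNReal.le_of_forall_pos_le_add fun ε hε _ => ?_) zero_le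
  rw [zero_add]
  set K := Real.exp (L * 5) with hK
  have hK0 : 0 < K := Real.exp_pos _
  have hε' : (0 : ℝ) < ε := hε
  set η : ℝ := ε / (5 * K ^ 2) with hη
  have hη0 : 0 < η := by positivity
  obtain ⟨ρ₀, hρ₀, hdens⟩ := hx (2 * η) (by positivity)
  obtain ⟨θ, hθ, hcont⟩ := Metric.continuousAt_iff.1 (Hc.continuousAt (x := y)) ρ₀ hρ₀
  obtain ⟨N, hN⟩ := exists_nat_gt (2 / θ)
  obtain ⟨r, hrN, hr⟩ := exists_rat_abs_sub_le_one_div_den_sq hα N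
  have hd : (0 : ℝ) < r.den := by exact_mod_cast r.den_pos
  have hd2 : (2 : ℝ) / r.den < θ := by
    have : (N : ℝ) < r.den := by exact_mod_cast hrN
    rw [div_lt_iff₀ hθ] at hN
    rw [div_lt_iff₀ hd]
    nlinarith
  have hd1 : (1 : ℝ) / r.den ≤ 2 / r.den := by gcongr; norm_num
  have hdp : (0 : ℝ) < 1 / r.den := by positivity
  set b₁ := H (y - 1 / r.den) with hb₁
  set b₂ := H (y + 2 / r.den) with hb₂
  have hy1 : b₁ ≤ H y := Hm (by linarith)
  have hy2 : H y ≤ b₂ := Hm (by linarith)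
  have hcov := Ico_subset_iUnion_image Hc Hm H1 Hf hr y
  have hb : b₁ < b₂ := by
    refine lt_of_le_of_ne (hy1.trans hy2) fun h => ?_
    rw [← hb₁, ← hb₂, h, Set.Icc_self] at hcov
    have hfin : (⋃ l ∈ Finset.range r.den,
        (fun z => f^[l] z - ((l * r.num / (r.den : ℤ) : ℤ) : ℝ)) '' {b₂}).Finite :=
      (Finset.range r.den).finite_toSet.biUnion fun l _ => (Set.finite_singleton _).image _
    exact Set.Ico_infinite (by linarith : H y < H y + 1) (hfin.subset hcov)
  have hsum : ∑ l ∈ Finset.range r.den, (f^[l] b₂ - f^[l] b₁) ≤ 5 := by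
    simp only [hb₁, hb₂, iterate_semiconj Hf]
    exact sum_length_le Hm H1 hr y
  have hdist : ∀ {z}, |z - y| < θ → |H z - H y| < ρ₀ := fun {z} hz => by
    have := hcont (x := z) (by rwa [Real.dist_eq])
    rwa [Real.dist_eq] at this
  have hr1 : |b₁ - H y| < ρ₀ := hdist (by
    rw [show y - 1 / r.den - y = -(1 / (r.den : ℝ)) by ring, abs_neg, abs_of_pos hdp]
    linarith)
  have hr2 : |b₂ - H y| < ρ₀ := hdist (by
    rw [show y + 2 / r.den - y = 2 / (r.den : ℝ) by ring, abs_of_pos (by positivity)]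
    exact hd2)
  have hI : volume (Set.Icc b₁ b₂ \ E) ≤ ENNReal.ofReal (η * (b₂ - b₁)) := by
    have h1 := hdens ((b₁ + b₂) / 2) ((b₂ - b₁) / 2) (by linarith)
      (by linarith [(abs_lt.1 hr1).1, (abs_lt.1 hr2).2]) (by
        rw [Metric.mem_closedBall, Real.dist_eq, abs_le]
        constructor <;> linarith)
    rw [Real.closedBall_eq_Icc, show (b₁ + b₂) / 2 - (b₂ - b₁) / 2 = b₁ by ring,
      show (b₁ + b₂) / 2 + (b₂ - b₁) / 2 = b₂ by ring,
      show 2 * η * ((b₂ - b₁) / 2) = η * (b₂ - b₁) by ring] at h1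
    exact h1
  have hEn : ∀ (l : ℕ) z, f^[l] z ∈ E ↔ z ∈ E := fun l => by
    induction l with
    | zero => exact fun z => Iff.rfl
    | succ l ih =>
      intro z
      rw [Function.iterate_succ_apply', hEf, ih]
  have hEz : ∀ (m : ℤ) (z : ℝ), z - m ∈ E ↔ z ∈ E := fun m z => by
    have : Function.Periodic (fun x => x ∈ E) 1 := fun x => propext (hE1 x)
    simpa using this.sub_int_mul_eq (x := z) m
  have hsub : Eᶜ ∩ Set.Ico (H y) (H y + 1) ⊆ ⋃ l ∈ Finset.range r.den,
      (fun z => z + ((l * r.num / (r.den : ℤ) : ℤ) : ℝ)) ⁻¹' (f^[l] '' (Set.Icc b₁ b₂ \ E)) := by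
    rintro z ⟨hzE, hz⟩
    obtain ⟨l, hl, w, hw, rfl⟩ := Set.mem_iUnion₂.1 (hcov hz)
    refine Set.mem_iUnion₂.2 ⟨l, hl, w, ⟨hw, fun hwE => hzE ?_⟩, ?_⟩
    · exact (hEz _ _).2 ((hEn l w).2 hwE)
    · simp
  calc volume (Eᶜ ∩ Set.Ico (H y) (H y + 1))
      ≤ ∑ l ∈ Finset.range r.den, volume ((fun z => z + ((l * r.num / (r.den : ℤ) : ℤ) : ℝ)) ⁻¹'
          (f^[l] '' (Set.Icc b₁ b₂ \ E))) :=
        (measure_mono hsub).trans (measure_biUnion_finset_le _ _)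
    _ ≤ ∑ l ∈ Finset.range r.den, ENNReal.ofReal (K ^ 2 * η * (f^[l] b₂ - f^[l] b₁)) := by
        refine Finset.sum_le_sum fun l hl => ?_
        rw [measure_preimage_add_right]
        exact p.volume_image_iterate_le hL hL0 hb.le hsum hI hη0 (Finset.mem_range.1 hl)
    _ = ENNReal.ofReal (K ^ 2 * η * ∑ l ∈ Finset.range r.den, (f^[l] b₂ - f^[l] b₁)) := by
        rw [Finset.mul_sum, ENNReal.ofReal_sum_of_nonneg fun l _ => ?_]
        have := (p.iterate l).strictMono.monotone hb.le
        exact mul_nonneg (by positivity) (by linarith)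
    _ ≤ ENNReal.ofReal ε := by
        refine ENNReal.ofReal_le_ofReal ?_
        calc K ^ 2 * η * ∑ l ∈ Finset.range r.den, (f^[l] b₂ - f^[l] b₁)
            ≤ K ^ 2 * η * 5 := by
              gcongr
          _ = (ε : ℝ) := by
              rw [hη]
              field_simp
    _ = ε := ENNReal.ofReal_coe_nnreal

end Semiconj

/-! ### Integer iterates and the derivative cocycle -/

namespace LiftPair

variable {f g : ℝ → ℝ}

/-- The permutation of the line underlying a pair of lifts. -/
def perm (p : LiftPair f g) : Equiv.Perm ℝ := ⟨f, g, p.inv_apply, p.apply_inv⟩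

theorem perm_zpow_natCast (p : LiftPair f g) (n : ℕ) (x : ℝ) : (p.perm ^ (n : ℤ)) x = f^[n] x := by
  rw [zpow_natCast, Equiv.Perm.coe_pow]
  rfl

theorem perm_zpow_neg_natCast (p : LiftPair f g) (n : ℕ) (x : ℝ) :
    (p.perm ^ (-(n : ℤ))) x = g^[n] x := by
  rw [zpow_neg, ← inv_zpow, zpow_natCast, Equiv.Perm.coe_pow]
  rfl

theorem zpowLift_eq (p : LiftPair f g) (i : ℤ) : zpowLift f i = ⇑(p.perm ^ i) := by
  funext x
  unfold zpowLift
  split_ifs with hi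
  · rw [← p.perm_zpow_natCast, Int.toNat_of_nonneg hi]
  · rw [p.invFun_eq, ← p.perm_zpow_neg_natCast, Int.toNat_of_nonneg (by omega), neg_neg]

theorem zpow (p : LiftPair f g) (i : ℤ) : LiftPair ⇑(p.perm ^ i) ⇑(p.perm ^ (-i)) := by
  obtain ⟨n, rfl | rfl⟩ := i.eq_nat_or_neg
  · rw [funext (p.perm_zpow_natCast n), funext (p.perm_zpow_neg_natCast n)]
    exact p.iterate n
  · rw [neg_neg, funext (p.perm_zpow_natCast n), funext (p.perm_zpow_neg_natCast n)]
    exact p.symm.iterate n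

theorem tendsto_cocycle (p : LiftPair f g) {w : ℕ → ℝ → ℝ} (hw : ∀ n x, 0 < w n x)
    (hlim : ∀ x, Tendsto (fun n => w n x / w n (f x)) atTop (𝓝 (deriv f x))) (i : ℤ) (x : ℝ) :
    Tendsto (fun n => w n x / w n ((p.perm ^ i) x)) atTop (𝓝 (deriv ⇑(p.perm ^ i) x)) := by
  have key : ∀ (j k : ℤ) (u : ℝ → ℝ), (∀ y, (p.perm ^ k) y = u ((p.perm ^ j) y)) →
      Differentiable ℝ u →
      (∀ y, Tendsto (fun n => w n y / w n (u y)) atTop (𝓝 (deriv u y))) →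
      Tendsto (fun n => w n x / w n ((p.perm ^ j) x)) atTop (𝓝 (deriv ⇑(p.perm ^ j) x)) →
      Tendsto (fun n => w n x / w n ((p.perm ^ k) x)) atTop (𝓝 (deriv ⇑(p.perm ^ k) x)) := by
    intro j k u hjk hu hul hj
    have h1 : deriv ⇑(p.perm ^ k) x = deriv ⇑(p.perm ^ j) x * deriv u ((p.perm ^ j) x) := by
      rw [funext hjk, mul_comm]
      exact ((hu _).hasDerivAt.comp x ((p.zpow j).differentiable x).hasDerivAt).deriv
    rw [h1, hjk]
    refine (hj.mul (hul ((p.perm ^ j) x))).congr fun n => ?_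
    exact div_mul_div_cancel₀ (hw n _).ne'
  have hinv : ∀ y, Tendsto (fun n => w n y / w n (g y)) atTop (𝓝 (deriv g y)) := fun y => by
    have h1 := p.deriv_mul_deriv_inv y
    rw [eq_inv_of_mul_eq_one_right h1]
    refine ((hlim (g y)).inv₀ (p.deriv_pos _).ne').congr fun n => ?_
    rw [p.apply_inv, inv_div]
  induction i using Int.induction_on with
  | zero =>
    have h1 : ⇑(p.perm ^ (0 : ℤ)) = id := by
      rw [zpow_zero]
      rfl
    rw [h1, deriv_id]
    exact tendsto_const_nhds.congr fun n => (div_self (hw n x).ne').symm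
  | succ i ih =>
    refine key i (i + 1) f (fun y => ?_) p.differentiable hlim ih
    rw [add_comm, zpow_add, zpow_one]
    rfl
  | pred i ih =>
    refine key (-i) (-i - 1) g (fun y => ?_) p.differentiable_inv hinv ih
    rw [sub_eq_add_neg, add_comm, zpow_add, zpow_neg_one]
    rfl

theorem volume_image_eq_zero (p : LiftPair f g) {S : Set ℝ} (hS : volume S = 0) :
    volume (f '' S) = 0 := by
  obtain ⟨K, -, hK⟩ := p.exists_lipschitzWith
  have := hK.hausdorffMeasure_image_le (d := 1) zero_le_one S
  rw [MeasureTheory.hausdorffMeasure_real, hS, mul_zero] at this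
  exact le_antisymm this zero_le

end LiftPair

/-! ### The values of the cocycle -/

section Cocycle

variable {R M : ℕ → ℝ} {D : ℝ} {K : ℕ}

theorem eventually_eq_of_steps (hM : ∀ n, 2 ≤ M n) (hR : ∀ n, 0 < R n) (hD : 0 < D)
    (hlim : Tendsto R atTop (𝓝 D))
    (hstep : ∀ n ≥ K, R (n + 1) = R n ∨ R (n + 1) = M n * R n ∨ R (n + 1) = R n / M n) :
    ∃ J ≥ K, D = R J := by
  have h1 : Tendsto (fun n => R (n + 1) / R n) atTop (𝓝 1) := by
    have := ((tendsto_add_atTop_iff_nat 1).2 hlim).div hlim hD.ne'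
    rwa [div_self hD.ne'] at this
  obtain ⟨J, hJ⟩ := eventually_atTop.1 (h1.eventually (Metric.ball_mem_nhds 1 one_half_pos))
  have h2 : ∀ n ≥ max J K, R (n + 1) = R n := by
    intro n hn
    have h3 : |R (n + 1) / R n - 1| < 1 / 2 := by
      have := hJ n (le_of_max_le_left hn)
      rwa [Real.dist_eq] at this
    rw [abs_lt] at h3
    rcases hstep n (le_of_max_le_right hn) with h | h | h
    · exact h
    · rw [h, mul_div_cancel_right₀ _ (hR n).ne'] at h3
      linarith [hM n]
    · rw [h, div_right_comm, div_self (hR n).ne'] at h3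
      have := one_div_le_one_div_of_le two_pos (hM n)
      linarith
  refine ⟨max J K, le_max_right _ _, ?_⟩
  have h4 : ∀ m, R (m + max J K) = R (max J K) := fun m => by
    induction m with
    | zero => simp
    | succ m ih => rw [show m + 1 + max J K = m + max J K + 1 by ring, h2 _ (by omega), ih]
  refine tendsto_nhds_unique ((tendsto_add_atTop_iff_nat (max J K)).2 hlim) ?_
  simp only [h4]
  exact tendsto_const_nhds

theorem eq_or_le_or_le_of_steps (hM : ∀ n, 2 ≤ M n) (hR : ∀ n, 0 < R n) (hD : 0 < D)
    (hlim : Tendsto R atTop (𝓝 D)) (hM1 : ∀ n, n + 1 ≤ M n * R n)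
    (hM2 : ∀ n, (n + 1) * (R n / M n) ≤ 1)
    (hstep : ∀ n ≥ K, R (n + 1) = R n ∨ R (n + 1) = M n * R n ∨ R (n + 1) = R n / M n)
    {n : ℕ} (hn : K ≤ n) : D = R n ∨ n + 1 ≤ D ∨ (n + 1) * D ≤ 1 := by
  obtain ⟨J, hJK, hJ⟩ := eventually_eq_of_steps hM hR hD hlim fun m hm => hstep m (hn.trans hm)
  obtain ⟨m, rfl⟩ := Nat.exists_eq_add_of_le hJK
  clear hJK
  induction m generalizing n with
  | zero => exact .inl hJ
  | succ m ih =>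
    have h := ih (n := n + 1) (by omega) (by rwa [show n + 1 + m = n + (m + 1) by ring])
    push_cast at h
    rcases h with h | h | h
    · rcases hstep n hn with h' | h' | h'
      · exact .inl (h.trans h')
      · exact .inr (.inl (by rw [h, h']; exact hM1 n))
      · exact .inr (.inr (by rw [h, h']; exact hM2 n))
    · exact .inr (.inl (by linarith))
    · exact .inr (.inr (by nlinarith))

end Cocycle

/-! ### Type `III₀` behaviour of step cocycles -/

/-- The derivative cocycle of `f` is the limit of the coboundaries of the periodic functions
`w n`, each of which is obtained from the previous one by a step. -/
structure IsStepCocycle (f : ℝ → ℝ) (w : ℕ → ℝ → ℝ) (δ s M : ℕ → ℝ) (T : ℕ → Set ℝ) :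
    Prop where
  pos : ∀ n x, 0 < w n x
  continuous : ∀ n, Continuous (w n)
  add_one : ∀ n x, w n (x + 1) = w n x
  step : ∀ n, IsStep n (δ n) (w n) (w (n + 1)) (s n) (M n) (T n)
  tendsto_zero : Tendsto δ atTop (𝓝 0)
  tendsto : ∀ x, Tendsto (fun n => w n x / w n (f x)) atTop (𝓝 (deriv f x))

/-- Every invariant Borel set of positive measure is conull. -/
def IsErgodicLift (f : ℝ → ℝ) : Prop :=
  ∀ E : Set ℝ, MeasurableSet E → (∀ x, x + 1 ∈ E ↔ x ∈ E) → (∀ x, f x ∈ E ↔ x ∈ E) →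
    volume E ≠ 0 → volume Eᶜ = 0

theorem IsErgodicLift.exists_volume_inter_preimage_ne_zero {f g : ℝ → ℝ} (h : IsErgodicLift f)
    (p : LiftPair f g) {A B : Set ℝ} (hA : volume A ≠ 0) (hB : MeasurableSet B)
    (hB1 : ∀ x, x + 1 ∈ B ↔ x ∈ B) (hB0 : volume B ≠ 0) :
    ∃ i : ℤ, volume (A ∩ (p.perm ^ i) ⁻¹' B) ≠ 0 := by
  by_contra! hcon
  have hE := h (⋃ i : ℤ, (p.perm ^ i) ⁻¹' B)
    (MeasurableSet.iUnion fun i => (p.zpow i).differentiable.continuous.measurable hB)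
    (fun x => by simp only [Set.mem_iUnion, Set.mem_preimage, (p.zpow _).add_one, hB1])
    (fun x => by
      simp only [Set.mem_iUnion, Set.mem_preimage]
      have : ∀ i : ℤ, (p.perm ^ i) (f x) = (p.perm ^ (i + 1)) x := fun i => by
        rw [zpow_add, zpow_one]
        rfl
      simp only [this]
      exact (Equiv.addRight (1 : ℤ)).exists_congr_left.trans (by simp))
    (fun h0 => hB0 (measure_mono_null (fun x hx => Set.mem_iUnion.2 ⟨0, by simpa using hx⟩) h0))
  refine hA (measure_mono_null (t := (⋃ i : ℤ, A ∩ (p.perm ^ i) ⁻¹' B) ∪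
    (⋃ i : ℤ, (p.perm ^ i) ⁻¹' B)ᶜ) (fun x hx => ?_)
    (measure_union_null (measure_iUnion_null hcon) hE))
  by_cases hx' : x ∈ ⋃ i : ℤ, (p.perm ^ i) ⁻¹' B
  · rw [← Set.inter_iUnion]
    exact .inl ⟨hx, hx'⟩
  · exact .inr hx'

namespace IsStepCocycle

variable {f g : ℝ → ℝ} {w : ℕ → ℝ → ℝ} {δ s M : ℕ → ℝ} {T : ℕ → Set ℝ}

theorem exists_volume_inter_ne_zero (c : IsStepCocycle f w δ s M T) {A : Set ℝ}
    (hA1 : ∀ x, x + 1 ∈ A ↔ x ∈ A) (hA0 : volume A ≠ 0) :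
    ∃ K, volume (A ∩ {x | ∀ n ≥ K, x ∉ T n}) ≠ 0 := by
  by_contra! hcon
  refine hA0 (volume_eq_zero_of_periodic hA1 0 ?_)
  have hsum : ∑' n, volume (T n ∩ Set.Ioc 0 1) ≠ ⊤ := by
    refine ne_top_of_le_ne_top ?_ (ENNReal.tsum_le_tsum fun n => (c.step n).volume_le)
    rw [← ENNReal.ofReal_tsum_of_nonneg (fun n => by positivity) summable_geometric_two]
    exact ENNReal.ofReal_ne_top
  have h0 : volume {x | ∃ᶠ n in atTop, x ∈ T n ∩ Set.Ioc 0 1} = 0 :=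
    measure_setOfPred_frequently_eq_zero hsum
  refine measure_mono_null (t := (⋃ K, A ∩ {x | ∀ n ≥ K, x ∉ T n}) ∪
    ({x | ∃ᶠ n in atTop, x ∈ T n ∩ Set.Ioc 0 1} ∪ {0})) (fun x hx => ?_)
    (measure_union_null (measure_iUnion_null hcon) (measure_union_null h0 (by simp)))
  by_cases hx' : ∃ K, ∀ n ≥ K, x ∉ T n
  · obtain ⟨K, hK⟩ := hx'
    exact .inl (Set.mem_iUnion.2 ⟨K, hx.1, hK⟩)
  · rcases eq_or_ne x 0 with h | h
    · exact .inr (.inr h)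
    · refine .inr (.inl (frequently_atTop.2 fun K => ?_))
      push Not at hx'
      obtain ⟨n, hn, hxn⟩ := hx' K
      exact ⟨n, hn, hxn, lt_of_le_of_ne hx.2.1 h.symm, by linarith [hx.2.2]⟩

theorem deriv_zpow_cases (c : IsStepCocycle f w δ s M T) (p : LiftPair f g) {K : ℕ} {i : ℤ}
    {x : ℝ} (hx : ∀ n ≥ K, x ∉ T n) (hy : ∀ n ≥ K, (p.perm ^ i) x ∉ T n) {n : ℕ} (hn : K ≤ n) :
    deriv ⇑(p.perm ^ i) x = w n x / w n ((p.perm ^ i) x) ∨ n + 1 ≤ deriv ⇑(p.perm ^ i) x ∨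
      (n + 1) * deriv ⇑(p.perm ^ i) x ≤ 1 := by
  have hM : ∀ n, 0 < M n := fun n => two_pos.trans_le (c.step n).two_le
  refine eq_or_le_or_le_of_steps (M := M) (fun n => (c.step n).two_le)
    (fun n => div_pos (c.pos n _) (c.pos n _)) ((p.zpow i).deriv_pos x)
    (p.tendsto_cocycle c.pos c.tendsto i x) (fun n => ?_) (fun n => ?_) (fun n hn => ?_) hn
  · rw [← mul_div_assoc, le_div_iff₀ (c.pos n _)]
    exact (c.step n).mul_le_mul _ _
  · rw [div_div, ← mul_div_assoc, div_le_one (mul_pos (c.pos n _) (hM n)), mul_comm (w n _)]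
    exact (c.step n).mul_le_mul _ _
  · have h1 := (c.step n).pos.ne'
    have h2 := (hM n).ne'
    have h3 := (c.pos n x).ne'
    have h4 := (c.pos n ((p.perm ^ i) x)).ne'
    rcases (c.step n).eq_or_eq x (hx n hn) with h | h <;>
      rcases (c.step n).eq_or_eq _ (hy n hn) with h' | h' <;> simp only [h, h']
    · exact .inl (by field_simp)
    · exact .inr (.inl (by field_simp))
    · exact .inr (.inr (by field_simp))
    · exact .inl (by field_simp)

theorem measurableSet_tail (c : IsStepCocycle f w δ s M T) (K : ℕ) :
    MeasurableSet {x | ∀ n ≥ K, x ∉ T n} := by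
  have : {x | ∀ n ≥ K, x ∉ T n} = ⋂ n ≥ K, (T n)ᶜ := by
    ext x
    simp
  rw [this]
  exact MeasurableSet.iInter fun n => MeasurableSet.iInter fun _ => (c.step n).measurableSet.compl

/-- Around a density point of `C`, both values of a late step are taken on non-null parts of
`C`. -/
theorem exists_step_volume_ne_zero (c : IsStepCocycle f w δ s M T) {C : Set ℝ}
    (hC : MeasurableSet C) (hC0 : volume C ≠ 0) : ∀ᶠ n in atTop,
      volume (C ∩ {y | w (n + 1) y = s n * w n y}) ≠ 0 ∧
        volume (C ∩ {y | w (n + 1) y = s n / M n * w n y}) ≠ 0 := by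
  obtain ⟨x, -, hx⟩ := exists_mem_of_ae hC0 (ae_volume_closedBall_diff_le hC)
  obtain ⟨r, hr, hd⟩ := hx (1 / 6) (by norm_num)
  filter_upwards [c.tendsto_zero.eventually (ge_mem_nhds hr)] with n hn
  obtain ⟨a, ρ, hρ, hρδ, hxa, hU, hV⟩ := (c.step n).exists_closedBall x
  have hdiff := hd a ρ hρ (hρδ.trans hn) hxa
  have key : ∀ U : Set ℝ, ENNReal.ofReal (ρ / 3) ≤ volume (Metric.closedBall a ρ ∩ U) →
      volume (C ∩ U) ≠ 0 := by
    intro U hU h0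
    have h1 : volume (Metric.closedBall a ρ ∩ U) ≤ ENNReal.ofReal (1 / 6 * ρ) := by
      calc _ ≤ volume ((Metric.closedBall a ρ \ C) ∪ (C ∩ U)) := measure_mono fun y hy => by
            by_cases hyC : y ∈ C
            · exact .inr ⟨hyC, hy.2⟩
            · exact .inl ⟨hy.1, hyC⟩
        _ ≤ volume (Metric.closedBall a ρ \ C) + volume (C ∩ U) := measure_union_le _ _
        _ ≤ _ := by rwa [h0, add_zero]
    have h2 := (ENNReal.ofReal_le_ofReal_iff (by positivity)).1 (hU.trans h1)
    linarith
  exact ⟨key _ hU, key _ hV⟩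

theorem exists_deriv_zpow_lt (c : IsStepCocycle f w δ s M T) (p : LiftPair f g)
    (herg : IsErgodicLift f) {A : Set ℝ} (hA : MeasurableSet A) (hA1 : ∀ x, x + 1 ∈ A ↔ x ∈ A)
    (hA0 : volume A ≠ 0) {ε : ℝ} (hε : 0 < ε) :
    ∃ B ⊆ A, MeasurableSet B ∧ (∀ x, x + 1 ∈ B ↔ x ∈ B) ∧ volume B ≠ 0 ∧ ∃ i : ℤ,
      (∀ x ∈ B, (p.perm ^ i) x ∈ A) ∧ ∀ x ∈ B, deriv ⇑(p.perm ^ i) x < ε := by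
  obtain ⟨K, hK⟩ := c.exists_volume_inter_ne_zero hA1 hA0
  set C := A ∩ {x | ∀ n ≥ K, x ∉ T n} with hCdef
  have hC : MeasurableSet C := hA.inter (c.measurableSet_tail K)
  have hC1 : ∀ x, x + 1 ∈ C ↔ x ∈ C := fun x => by
    simp only [hCdef, Set.mem_inter_iff, Set.mem_ofPred_eq, hA1, (c.step _).add_one_mem]
  obtain ⟨n, ⟨hU, hV⟩, hnK, hnε⟩ := ((c.exists_step_volume_ne_zero hC hK).and
    ((eventually_ge_atTop K).and
      (tendsto_one_div_add_atTop_nhds_zero_nat.eventually (gt_mem_nhds hε)))).exists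
  set U := C ∩ {y | w (n + 1) y = s n * w n y} with hUdef
  set V := C ∩ {y | w (n + 1) y = s n / M n * w n y} with hVdef
  have hcont := fun n => (c.continuous n).measurable
  have hUm : MeasurableSet U :=
    hC.inter (measurableSet_eq_fun (hcont _) ((hcont _).const_mul _))
  have hVm : MeasurableSet V :=
    hC.inter (measurableSet_eq_fun (hcont _) ((hcont _).const_mul _))
  have hU1 : ∀ x, x + 1 ∈ U ↔ x ∈ U := fun x => by
    simp only [hUdef, Set.mem_inter_iff, Set.mem_ofPred_eq, hC1, c.add_one]
  have hV1 : ∀ x, x + 1 ∈ V ↔ x ∈ V := fun x => by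
    simp only [hVdef, Set.mem_inter_iff, Set.mem_ofPred_eq, hC1, c.add_one]
  obtain ⟨i, hi⟩ := herg.exists_volume_inter_preimage_ne_zero p hU hVm hV1 hV
  set B := U ∩ (p.perm ^ i) ⁻¹' V with hBdef
  have hBm : MeasurableSet B := hUm.inter ((p.zpow i).differentiable.continuous.measurable hVm)
  have hB1 : ∀ x, x + 1 ∈ B ↔ x ∈ B := fun x => by
    simp only [hBdef, Set.mem_inter_iff, Set.mem_preimage, (p.zpow i).add_one, hU1, hV1]
  have hn : (0 : ℝ) < n + 1 := by positivity
  rw [one_div] at hnε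
  have hcases : ∀ x ∈ B, (n : ℝ) + 1 ≤ deriv ⇑(p.perm ^ i) x ∨
      (n + 1) * deriv ⇑(p.perm ^ i) x ≤ 1 := by
    rintro x ⟨⟨hxC, hxU⟩, hyC, hyV⟩
    rcases c.deriv_zpow_cases p hxC.2 hyC.2 (n := n + 1) (by omega) with h | h | h
    · left
      rw [Set.mem_ofPred_eq] at hxU hyV
      have h1 := (c.step n).pos.ne'
      have h2 := two_pos.trans_le (c.step n).two_le
      have h3 := (c.step n).mul_le_mul ((p.perm ^ i) x) x
      have h4 := c.pos n ((p.perm ^ i) x)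
      have h5 : w (n + 1) x / w (n + 1) ((p.perm ^ i) x) =
          M n * w n x / w n ((p.perm ^ i) x) := by
        rw [hxU, hyV]
        field_simp
      rwa [h, h5, le_div_iff₀ h4]
    · left
      push_cast at h
      linarith
    · right
      push_cast at h
      nlinarith [(p.zpow i).deriv_pos x]
  have hdm : Measurable (deriv ⇑(p.perm ^ i)) := measurable_deriv _
  by_cases hsmall : volume (B ∩ {x | (n + 1) * deriv ⇑(p.perm ^ i) x ≤ 1}) = 0
  · set L := B ∩ {x | (n : ℝ) + 1 ≤ deriv ⇑(p.perm ^ i) x} with hLdef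
    have hL0 : volume L ≠ 0 := fun h0 => hi (measure_mono_null (fun x hx =>
      (hcases x hx).elim (fun h => .inl ⟨hx, h⟩) fun h => .inr ⟨hx, h⟩)
      (measure_union_null h0 hsmall))
    have hLm : MeasurableSet L := hBm.inter (measurableSet_le measurable_const hdm)
    have hinv : ∀ x, (p.perm ^ i) ((p.perm ^ (-i)) x) = x := (p.zpow i).apply_inv
    refine ⟨(p.perm ^ (-i)) ⁻¹' L, fun x hx => ?_,
      (p.zpow (-i)).differentiable.continuous.measurable hLm, fun x => ?_, fun h0 => ?_, -i,
      fun x hx => hx.1.1.1.1, fun x hx => ?_⟩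
    · have h1 : (p.perm ^ i) ((p.perm ^ (-i)) x) ∈ V := hx.1.2
      rw [hinv] at h1
      exact h1.1.1
    · simp only [hLdef, Set.mem_preimage, Set.mem_inter_iff, Set.mem_ofPred_eq,
        (p.zpow (-i)).add_one, hB1]
      rw [(p.zpow i).deriv_periodic]
    · have h1 := (p.zpow (-i)).volume_image_eq_zero h0
      rw [Set.image_preimage_eq _ (p.perm ^ (-i)).surjective] at h1
      exact hL0 h1
    · have h1 := (p.zpow i).deriv_mul_deriv_inv x
      have h2 : (n : ℝ) + 1 ≤ deriv ⇑(p.perm ^ i) ((p.perm ^ (-i)) x) := hx.2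
      refine lt_of_le_of_lt ?_ hnε
      rw [eq_inv_of_mul_eq_one_right h1]
      exact inv_anti₀ hn h2
  · refine ⟨B ∩ {x | (n + 1) * deriv ⇑(p.perm ^ i) x ≤ 1}, fun x hx => hx.1.1.1.1,
      hBm.inter (measurableSet_le (hdm.const_mul _) measurable_const), fun x => ?_, hsmall, i,
      fun x hx => hx.1.2.1.1, fun x hx => ?_⟩
    · simp only [Set.mem_inter_iff, Set.mem_ofPred_eq, hB1]
      rw [(p.zpow i).deriv_periodic]
    · refine lt_of_le_of_lt ?_ hnε
      have h1 : (n + 1) * deriv ⇑(p.perm ^ i) x ≤ 1 := hx.2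
      rw [← one_div, le_div_iff₀ hn]
      linarith

theorem exists_le_abs_deriv_zpow_sub (c : IsStepCocycle f w δ s M T) (p : LiftPair f g)
    {t : ℝ} (ht : 0 < t) (ht1 : t ≠ 1) :
    ∃ A : Set ℝ, MeasurableSet A ∧ (∀ x, x + 1 ∈ A ↔ x ∈ A) ∧ volume A ≠ 0 ∧ ∃ ε > 0,
      ∀ x ∈ A, ∀ i : ℤ, (p.perm ^ i) x ∈ A → ε ≤ |deriv ⇑(p.perm ^ i) x - t| := by
  obtain ⟨K₀, hK₀⟩ := c.exists_volume_inter_ne_zero (A := Set.univ) (by simp) (by simp)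
  rw [Set.univ_inter] at hK₀
  obtain ⟨K, hK, hKt, hKt'⟩ := ((eventually_ge_atTop K₀).and
    ((tendsto_natCast_atTop_atTop.eventually_ge_atTop t).and
      (tendsto_natCast_atTop_atTop.eventually_ge_atTop (2 / t)))).exists
  have hG : volume {x | ∀ n ≥ K, x ∉ T n} ≠ 0 := fun h0 =>
    hK₀ (measure_mono_null (fun x hx n hn => hx n (hK.trans hn)) h0)
  set η := |t - 1| / 2 with hη
  have hη0 : 0 < η := by
    have := abs_pos.2 (sub_ne_zero.2 ht1)
    positivity
  obtain ⟨x₀, hx₀⟩ : ∃ x₀ : ℝ, volume ({x | ∀ n ≥ K, x ∉ T n} ∩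
      {x | |Real.log (w K x) - x₀| ≤ Real.log (1 + η) / 2}) ≠ 0 := by
    by_contra! hcon
    refine hG (measure_mono_null (fun x hx => ?_)
      (measure_iUnion_null fun q : ℚ => hcon q))
    have hl : 0 < Real.log (1 + η) / 2 := by
      have := Real.log_pos (show 1 < 1 + η by linarith)
      positivity
    obtain ⟨q, hq1, hq2⟩ := exists_rat_btwn
      (show Real.log (w K x) - Real.log (1 + η) / 2 < Real.log (w K x) by linarith)
    refine Set.mem_iUnion.2 ⟨q, hx, ?_⟩
    rw [Set.mem_ofPred_eq, abs_le]
    constructor <;> linarith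
  refine ⟨_, (c.measurableSet_tail K).inter (measurableSet_le
    (((Real.measurable_log.comp (c.continuous K).measurable).sub_const _).abs)
    measurable_const), fun x => ?_, hx₀, min η (min 1 (t / 2)), by positivity, ?_⟩
  · simp only [Set.mem_inter_iff, Set.mem_ofPred_eq, (c.step _).add_one_mem,
      Function.comp_apply, c.add_one]
  · rintro x ⟨hxG, hxl⟩ i ⟨hyG, hyl⟩
    have hxp := c.pos K x
    have hyp := c.pos K ((p.perm ^ i) x)
    rcases c.deriv_zpow_cases p hxG hyG le_rfl with h | h | h
    · refine (min_le_left _ _).trans ?_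
      have hlog : |Real.log (w K x / w K ((p.perm ^ i) x))| ≤ Real.log (1 + η) := by
        rw [Real.log_div hxp.ne' hyp.ne', abs_le]
        rw [Set.mem_ofPred_eq, Function.comp_apply, abs_le] at hxl hyl
        constructor <;> linarith
      rw [← h, abs_le] at hlog
      have hD := (p.zpow i).deriv_pos x
      have h1 := (Real.log_le_log_iff hD (by positivity)).1 hlog.2
      rw [← Real.log_inv] at hlog
      have h2 := (Real.log_le_log_iff (by positivity) hD).1 hlog.1
      have h3 : 1 - η ≤ (1 + η)⁻¹ := by
        rw [← one_div, le_div_iff₀ (by positivity)]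
        nlinarith
      have h4 : |deriv ⇑(p.perm ^ i) x - 1| ≤ η := abs_le.2 ⟨by linarith, by linarith⟩
      have h5 := abs_sub_abs_le_abs_sub (t - 1) (deriv ⇑(p.perm ^ i) x - 1)
      rw [show t - 1 - (deriv ⇑(p.perm ^ i) x - 1) = -(deriv ⇑(p.perm ^ i) x - t) by ring,
        abs_neg] at h5
      linarith
    · refine (min_le_right _ _).trans ((min_le_left _ _).trans ?_)
      rw [le_abs]
      left
      linarith
    · refine (min_le_right _ _).trans ((min_le_right _ _).trans ?_)
      rw [le_abs]
      right
      rw [div_le_iff₀ ht] at hKt'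
      nlinarith [(p.zpow i).deriv_pos x]

end IsStepCocycle

/-! ### Passage to the circle -/

theorem volume_coe_preimage_eq_zero_iff {S : Set UnitAddCircle} (hS : MeasurableSet S) :
    volume ((fun x : ℝ => (x : UnitAddCircle)) ⁻¹' S) = 0 ↔ volume S = 0 := by
  have hmk := UnitAddCircle.measurePreserving_mk 0
  have h1 := hmk.measure_preimage hS.nullMeasurableSet
  rw [Measure.restrict_apply (hmk.measurable hS)] at h1
  rw [← h1]
  refine ⟨fun h => measure_mono_null Set.inter_subset_left h, fun h =>
    volume_eq_zero_of_periodic (fun x => by simp) 0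
      (measure_mono_null (t := _ ∪ {0}) (fun x hx => ?_) (measure_union_null h (by simp)))⟩
  rcases eq_or_ne x 0 with h0 | h0
  · exact .inr h0
  · exact .inl ⟨hx.1, lt_of_le_of_ne hx.2.1 h0.symm, hx.2.2.le⟩

theorem exists_coe_preimage_eq {B : Set ℝ} (hB : MeasurableSet B)
    (hB1 : ∀ x, x + 1 ∈ B ↔ x ∈ B) :
    ∃ S : Set UnitAddCircle, MeasurableSet S ∧ (fun x : ℝ => (x : UnitAddCircle)) ⁻¹' S = B := by
  have hper : Function.Periodic (fun x => x ∈ B) 1 := fun x => propext (hB1 x)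
  refine ⟨{z | (AddCircle.measurableEquivIoc 1 0 z : ℝ) ∈ B},
    (measurable_subtype_coe.comp (AddCircle.measurableEquivIoc 1 0).measurable) hB, ?_⟩
  ext x
  obtain ⟨m, hm⟩ : ∃ m : ℤ, (AddCircle.measurableEquivIoc (1 : ℝ) 0 (x : UnitAddCircle) : ℝ) =
      x - m * 1 := by
    refine ⟨toIocDiv one_pos 0 x, ?_⟩
    rw [← zsmul_eq_mul, self_sub_toIocDiv_zsmul]
    rfl
  rw [Set.mem_preimage, Set.mem_ofPred_eq, hm]
  exact iff_of_eq (hper.sub_int_mul_eq m)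

theorem IsStepCocycle.ratioSet_eq {f g : ℝ → ℝ} {w : ℕ → ℝ → ℝ} {δ s M : ℕ → ℝ}
    {T : ℕ → Set ℝ} (c : IsStepCocycle f w δ s M T) (p : LiftPair f g) (herg : IsErgodicLift f)
    {Fz : ℤ → UnitAddCircle → UnitAddCircle} {D : ℤ → UnitAddCircle → ℝ}
    (hFz : ∀ (i : ℤ) (x : ℝ), Fz i x = ((p.perm ^ i) x : ℝ))
    (hD : ∀ (i : ℤ) (x : ℝ), D i x = deriv ⇑(p.perm ^ i) x) : ratioSet Fz D = {0, 1} := by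
  have hmk : Measurable (fun x : ℝ => (x : UnitAddCircle)) :=
    (UnitAddCircle.measurePreserving_mk 0).measurable
  refine Set.Subset.antisymm (fun t ht => ?_) ?_
  · by_contra hcon
    simp only [Set.mem_insert_iff, Set.mem_singleton_iff, not_or] at hcon
    obtain ⟨A, hA, hA1, hA0, ε, hε, h⟩ :=
      c.exists_le_abs_deriv_zpow_sub p (lt_of_le_of_ne ht.1 (Ne.symm hcon.1)) hcon.2
    obtain ⟨A, hA, rfl⟩ := exists_coe_preimage_eq hA hA1
    rw [Ne, volume_coe_preimage_eq_zero_iff hA] at hA0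
    obtain ⟨B, -, hBA, hB0, i, hi, hiD⟩ := ht.2 A hA (pos_iff_ne_zero.2 hA0) ε hε
    obtain ⟨z, hz⟩ := nonempty_of_measure_ne_zero hB0.ne'
    obtain ⟨x, rfl⟩ := QuotientAddGroup.mk_surjective z
    have h1 := hi ⟨_, hz, rfl⟩
    have h2 := hiD _ hz
    rw [hFz] at h1
    rw [hD] at h2
    exact (h x (hBA hz) i h1).not_gt h2
  · rintro t (rfl | rfl)
    · refine ⟨le_rfl, fun A hA hA0 ε hε => ?_⟩
      obtain ⟨B, hBA, hB, hB1, hB0, i, hi, hiD⟩ := c.exists_deriv_zpow_lt p herg (hmk hA)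
        (fun x => by simp) ((volume_coe_preimage_eq_zero_iff hA).not.2 hA0.ne') hε
      obtain ⟨B, hB, rfl⟩ := exists_coe_preimage_eq hB hB1
      rw [Ne, volume_coe_preimage_eq_zero_iff hB] at hB0
      refine ⟨B, hB, fun z hz => ?_, pos_iff_ne_zero.2 hB0, i, ?_, fun z hz => ?_⟩
      · obtain ⟨x, rfl⟩ := QuotientAddGroup.mk_surjective z
        exact hBA hz
      · rintro _ ⟨z, hz, rfl⟩
        obtain ⟨x, rfl⟩ := QuotientAddGroup.mk_surjective z
        rw [hFz]
        exact hi x hz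
      · obtain ⟨x, rfl⟩ := QuotientAddGroup.mk_surjective z
        rw [hD, sub_zero, abs_of_pos ((p.zpow i).deriv_pos x)]
        exact hiD x hz
    · refine ⟨zero_le_one, fun A hA hA0 ε hε => ⟨A, hA, subset_rfl, hA0, 0, ?_, fun z _ => ?_⟩⟩
      · rintro _ ⟨z, hz, rfl⟩
        obtain ⟨x, rfl⟩ := QuotientAddGroup.mk_surjective z
        rw [hFz]
        exact hz
      · obtain ⟨x, rfl⟩ := QuotientAddGroup.mk_surjective z
        have h1 : ⇑(p.perm ^ (0 : ℤ)) = id := by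
          rw [zpow_zero]
          rfl
        rwa [hD, h1, deriv_id, sub_self, abs_zero]

theorem LiftPair.exists_circle_iterates {f g : ℝ → ℝ} (p : LiftPair f g) :
    ∃ (Fz : ℤ → UnitAddCircle → UnitAddCircle) (D : ℤ → UnitAddCircle → ℝ),
      (∀ (i : ℤ) (x : ℝ), Fz i x = ((p.perm ^ i) x : ℝ)) ∧
        ∀ (i : ℤ) (x : ℝ), D i x = deriv ⇑(p.perm ^ i) x := by
  have hF : ∀ i : ℤ, Function.Periodic (fun x : ℝ => (((p.perm ^ i) x : ℝ) : UnitAddCircle)) 1 :=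
    fun i x => by
      show (((p.perm ^ i) (x + 1) : ℝ) : UnitAddCircle) = _
      rw [(p.zpow i).add_one]
      simp
  exact ⟨fun i => (hF i).lift, fun i => (p.zpow i).deriv_periodic.lift,
    fun _ _ => Function.Periodic.lift_coe _ _, fun _ _ => Function.Periodic.lift_coe _ _⟩

theorem hasRotationNumber_of_semiconj {f H : ℝ → ℝ} {α : ℝ} (Hc : Continuous H)
    (H1 : ∀ y, H (y + 1) = H y + 1) (Hf : ∀ y, f (H y) = H (y + α)) : HasRotationNumber f α := by
  obtain ⟨y, hy⟩ := surjective_of_add_one Hc H1 0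
  have hper : Function.Periodic (fun x => H x - x) 1 := fun x => by
    simp only [H1]
    ring
  obtain ⟨C, -, hC⟩ := abs_le_of_continuous_of_periodic (Hc.sub continuous_id) hper
  refine ⟨0, ?_⟩
  rw [Int.cast_zero, add_zero]
  have h1 : Tendsto (fun n : ℕ => (C + |y|) / n) atTop (𝓝 0) :=
    tendsto_const_div_atTop_nhds_zero_nat _
  rw [tendsto_iff_dist_tendsto_zero]
  refine squeeze_zero' (.of_forall fun _ => dist_nonneg) ?_ h1
  filter_upwards [eventually_gt_atTop 0] with n hn
  have hn' : (0 : ℝ) < n := by exact_mod_cast hn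
  rw [← hy, iterate_semiconj Hf, Real.dist_eq,
    show H (y + n * α) / n - α = (H (y + n * α) - n * α) / n by field_simp, abs_div,
    abs_of_pos hn']
  gcongr
  calc |H (y + n * α) - n * α| = |(H (y + n * α) - (y + n * α)) + y| := by ring_nf
    _ ≤ |H (y + n * α) - (y + n * α)| + |y| := abs_add_le _ _
    _ ≤ C + |y| := by
      gcongr
      exact hC _

/-- For a Liouville number `α ∈ (0,1)` and any `r`, there is a type `III₀` smooth circle
diffeomorphism with rotation number `α` whose lift is `2^{-r}`-close to `R_α` in `d_r`. -/
theorem stmt_8 (α : ℝ) (hα0 : 0 < α) (hα1 : α < 1) (hL : Liouville α) (r : ℕ) :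
    ∃ f : ℝ → ℝ, IsCircleDiffeoLift f ∧ HasRotationNumber f α ∧
      liftDist r f (RotLift α) < ((2 : ℝ) ^ r)⁻¹ ∧
      ∃ Fz : ℤ → UnitAddCircle → UnitAddCircle, ∃ D : ℤ → UnitAddCircle → ℝ,
        (∀ i : ℤ, ∀ x : ℝ, Fz i ↑x = ↑(zpowLift f i x)) ∧
        (∀ i : ℤ, ∀ x : ℝ, D i ↑x = deriv (zpowLift f i) x) ∧
        ratioSet Fz D = ({0, 1} : Set ℝ) := by
  obtain ⟨h, k, δ, s, M, T, c⟩ := exists_isConjSeq hL r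
  obtain ⟨H, Hc, Hm, H1, hH⟩ := c.exists_semiconj
  obtain ⟨f, g, p, hf, hg, hfh, hlim⟩ := c.exists_diffeo
  have Hf := c.apply_semiconj p.smooth.continuous hfh hH
  have herg : IsErgodicLift f := fun E hE hE1 hEf hE0 =>
    p.volume_compl_eq_zero hL.irrational Hc Hm H1 Hf hE hE1 hEf hE0
  have hcocycle : IsStepCocycle f (fun n => deriv (k n)) δ s M T :=
    { pos := fun n => (c.pair n).symm.deriv_pos
      continuous := fun n => (c.pair n).symm.continuous_deriv
      add_one := fun n => (c.pair n).symm.deriv_periodic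
      step := c.step
      tendsto_zero := c.tendsto_zero
      tendsto := hlim }
  obtain ⟨Fz, D, hFz, hD⟩ := p.exists_circle_iterates
  have hRot : Function.invFun (RotLift α) = fun x => x - α := (LiftPair.add_const α).invFun_eq
  refine ⟨f, p.isCircleDiffeoLift, hasRotationNumber_of_semiconj Hc H1 Hf, ?_, Fz, D, ?_, ?_,
    hcocycle.ratioSet_eq p herg hFz hD⟩
  · rw [liftDist, p.invFun_eq, hRot]
    exact max_lt hf hg
  · simpa only [p.zpowLift_eq] using hFz
  · simpa only [p.zpowLift_eq] using hD
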